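/- arXiv:math/0212035 — 10 statements merged into one kernel-verified Lean document; each statement's English description precedes it below -/
import Mathlib

section
/- Let t and x be complex numbers with |x| < 1 and |t·x| < 1. Then ∑_{n=1}^∞ Log(1 - t·x^n) = - ∑_{k=1}^∞ (t^k/k) · x^k/(1 - x^k), where Log denotes the principal branch of the complex logarithm; both series converge absolutely. -/
/-- The double series `∑_{n,k ≥ 1} (t x^n)^k / k` converges absolutely when `‖x‖ < 1` and
`‖t * x‖ < 1`. -/
theorem summable_mul_pow_pow_div {t x : ℂ} (hx : ‖x‖ < 1) (htx : ‖t * x‖ < 1) :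
    Summable (fun p : ℕ × ℕ => (t * x ^ (p.1 + 1)) ^ (p.2 + 1) / ((p.2 : ℂ) + 1)) := by
  have hbound : Summable (fun p : ℕ × ℕ => ‖x‖ ^ p.1 * ‖t * x‖ ^ p.2) :=
    (summable_geometric_of_lt_one (norm_nonneg _) hx).mul_of_nonneg
      (summable_geometric_of_lt_one (norm_nonneg _) htx)
      (fun _ => by positivity) (fun _ => by positivity)
  refine Summable.of_norm_bounded hbound fun p => ?_
  have hden : (1 : ℝ) ≤ ‖(p.2 : ℂ) + 1‖ := by
    rw [← Nat.cast_succ, Complex.norm_natCast]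
    exact_mod_cast Nat.succ_pos p.2
  have hsplit : (t * x ^ (p.1 + 1)) ^ (p.2 + 1) = (x ^ p.1) ^ (p.2 + 1) * (t * x) ^ (p.2 + 1) := by
    rw [← mul_pow]
    ring
  rw [norm_div, hsplit, norm_mul]
  refine (div_le_self (by positivity) hden).trans ?_
  simp only [norm_pow]
  refine mul_le_mul ?_ ?_ (by positivity) (by positivity)
  · exact pow_le_of_le_one (by positivity) (pow_le_one₀ (norm_nonneg _) hx.le) (Nat.succ_ne_zero _)
  · exact pow_le_pow_of_le_one (norm_nonneg _) htx.le (Nat.le_succ _)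

/-- Summing the double series over `n` gives a Lambert series term. -/
theorem hasSum_mul_pow_pow_div (t : ℂ) {x : ℂ} (hx : ‖x‖ < 1) (k : ℕ) :
    HasSum (fun n : ℕ => (t * x ^ (n + 1)) ^ (k + 1) / ((k : ℂ) + 1))
      (t ^ (k + 1) / ((k : ℂ) + 1) * (x ^ (k + 1) / (1 - x ^ (k + 1)))) := by
  have hlt : ‖x ^ (k + 1)‖ < 1 := by
    rw [norm_pow]
    exact pow_lt_one₀ (norm_nonneg _) hx (Nat.succ_ne_zero k)
  have h := (hasSum_geometric_of_norm_lt_one hlt).mul_left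
    (t ^ (k + 1) / ((k : ℂ) + 1) * x ^ (k + 1))
  rw [mul_assoc, ← div_eq_mul_inv] at h
  have hterm (n : ℕ) : (t * x ^ (n + 1)) ^ (k + 1) / ((k : ℂ) + 1) =
      t ^ (k + 1) / ((k : ℂ) + 1) * x ^ (k + 1) * (x ^ (k + 1)) ^ n := by
    rw [mul_pow, ← pow_mul, ← pow_mul]
    ring
  simpa only [hterm] using h

/-- For complex `t`, `x` with `‖x‖ < 1` and `‖t*x‖ < 1`, the series
`∑_{n=1}^∞ Log(1 - t x^n)` and `∑_{k=1}^∞ (t^k/k) x^k/(1-x^k)` converge absolutely and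
`∑_{n=1}^∞ Log(1 - t x^n) = - ∑_{k=1}^∞ (t^k/k) x^k/(1-x^k)`. -/
theorem stmt0 (t x : ℂ) (hx : ‖x‖ < 1) (htx : ‖t * x‖ < 1) :
    Summable (fun n : ℕ => ‖Complex.log (1 - t * x ^ (n + 1))‖) ∧
    Summable (fun k : ℕ =>
      ‖t ^ (k + 1) / ((k : ℂ) + 1) * (x ^ (k + 1) / (1 - x ^ (k + 1)))‖) ∧
    ∑' n : ℕ, Complex.log (1 - t * x ^ (n + 1)) =
      - ∑' k : ℕ, t ^ (k + 1) / ((k : ℂ) + 1) * (x ^ (k + 1) / (1 - x ^ (k + 1))) := by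
  have hF := summable_mul_pow_pow_div hx htx
  have hnorm (n : ℕ) : ‖t * x ^ (n + 1)‖ < 1 := by
    rw [pow_succ', ← mul_assoc, norm_mul, norm_pow]
    exact (mul_le_of_le_one_right (norm_nonneg _)
      (pow_le_one₀ (norm_nonneg _) hx.le)).trans_lt htx
  have hrow (n : ℕ) : HasSum (fun k : ℕ => (t * x ^ (n + 1)) ^ (k + 1) / ((k : ℂ) + 1))
      (-Complex.log (1 - t * x ^ (n + 1))) :=
    Complex.hasSum_taylorSeries_neg_log' (hnorm n)
  obtain ⟨S, hS⟩ := hF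
  have hlog : HasSum (fun n : ℕ => -Complex.log (1 - t * x ^ (n + 1))) S :=
    HasSum.prod_fiberwise hS hrow
  have hlambert : HasSum (fun k : ℕ =>
      t ^ (k + 1) / ((k : ℂ) + 1) * (x ^ (k + 1) / (1 - x ^ (k + 1)))) S :=
    HasSum.prod_fiberwise ((Equiv.prodComm ℕ ℕ).hasSum_iff.mpr hS)
      fun k => hasSum_mul_pow_pow_div t hx k
  refine ⟨?_, hlambert.summable.norm, ?_⟩
  · simpa only [norm_neg] using hlog.summable.norm
  · rw [hlambert.tsum_eq, ← hlog.tsum_eq, tsum_neg, neg_neg]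
end

section
/- Let t and x be complex numbers with |x| < 1 and |t·x| < 1. Then |∑_{k=1}^∞ (t^k/k) · x^k/(1 - x^k)| ≤ -log(1 - |t·x|)/(1 - |x|), and consequently (1 - |t·x|)^{1/(1-|x|)} ≤ |∏_{n=1}^∞ (1 - t·x^n)| ≤ (1 - |t·x|)^{-1/(1-|x|)}. -/
/-- The double series `∑ (z x ^ j) ^ (k + 1) / (k + 1)`, summed along either index; the total is
bounded by `-log (1 - ‖z‖) / (1 - ‖x‖)`. -/
theorem exists_hasSum_log_one_sub_mul_pow {z x : ℂ} (hx : ‖x‖ < 1) (hz : ‖z‖ < 1) :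
    ∃ S : ℂ, HasSum (fun k : ℕ ↦ z ^ (k + 1) / ((k : ℂ) + 1) * (1 - x ^ (k + 1))⁻¹) S ∧
      HasSum (fun j : ℕ ↦ -Complex.log (1 - z * x ^ j)) S ∧
      ‖S‖ ≤ -Real.log (1 - ‖z‖) / (1 - ‖x‖) := by
  have hlog : HasSum (fun k : ℕ ↦ ‖z‖ ^ (k + 1) / ((k : ℝ) + 1)) (-Real.log (1 - ‖z‖)) :=
    Real.hasSum_pow_div_log_of_abs_lt_one (by rwa [abs_norm])
  have hgeom := hasSum_geometric_of_lt_one (norm_nonneg x) hx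
  have hb := hlog.mul hgeom <| hlog.summable.mul_of_nonneg hgeom.summable
    (fun k ↦ by positivity) (fun j ↦ by positivity)
  let f : ℕ × ℕ → ℂ := fun p ↦ (z * x ^ p.2) ^ (p.1 + 1) / ((p.1 : ℂ) + 1)
  have hfb (p : ℕ × ℕ) : ‖f p‖ ≤ ‖z‖ ^ (p.1 + 1) / ((p.1 : ℝ) + 1) * ‖x‖ ^ p.2 := by
    have hcast : ‖(p.1 : ℂ) + 1‖ = (p.1 : ℝ) + 1 := by
      exact_mod_cast Complex.norm_natCast (p.1 + 1)
    simp only [f, norm_div, norm_pow, norm_mul, mul_pow, hcast]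
    rw [mul_div_right_comm]
    gcongr
    exact pow_le_of_le_one (by positivity) (pow_le_one₀ (norm_nonneg x) hx.le) p.1.succ_ne_zero
  have hf : Summable f := .of_norm_bounded hb.summable hfb
  refine ⟨∑' p, f p, hf.hasSum.prod_fiberwise fun k ↦ ?_,
    ((Equiv.prodComm ℕ ℕ).hasSum_iff.mpr hf.hasSum).prod_fiberwise fun j ↦ ?_, ?_⟩
  · have hxk : ‖x ^ (k + 1)‖ < 1 := by
      rw [norm_pow]
      exact pow_lt_one₀ (norm_nonneg x) hx k.succ_ne_zero
    refine ((hasSum_geometric_of_norm_lt_one hxk).mul_left _).congr_fun ?_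
    intro j
    simp only [f]
    ring
  · have hzj : ‖z * x ^ j‖ < 1 := by
      rw [norm_mul, norm_pow]
      exact (mul_le_of_le_one_right (norm_nonneg z) (pow_le_one₀ (norm_nonneg x) hx.le)).trans_lt hz
    simpa [f] using Complex.hasSum_taylorSeries_neg_log' hzj
  · simpa only [div_eq_mul_inv] using tsum_of_norm_bounded hb hfb

/-- Lemma 2.1: For complex `t`, `x` with `‖x‖ < 1` and `‖t*x‖ < 1`,
`|∑_{k≥1} (t^k/k) x^k/(1-x^k)| ≤ -log(1-|tx|)/(1-|x|)` and consequently
`(1-|tx|)^{1/(1-|x|)} ≤ |∏_{n≥1} (1 - t x^n)| ≤ (1-|tx|)^{-1/(1-|x|)}`. -/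
theorem stmt1 (t x : ℂ) (hx : ‖x‖ < 1) (htx : ‖t * x‖ < 1) :
    ‖∑' k : ℕ, t ^ (k + 1) / ((k : ℂ) + 1) * (x ^ (k + 1) / (1 - x ^ (k + 1)))‖ ≤
      -Real.log (1 - ‖t * x‖) / (1 - ‖x‖) ∧
    (1 - ‖t * x‖) ^ ((1 : ℝ) / (1 - ‖x‖)) ≤ ‖∏' n : ℕ, (1 - t * x ^ (n + 1))‖ ∧
    ‖∏' n : ℕ, (1 - t * x ^ (n + 1))‖ ≤ (1 - ‖t * x‖) ^ (-(1 : ℝ) / (1 - ‖x‖)) := by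
  have h1z : 0 < 1 - ‖t * x‖ := sub_pos.mpr htx
  obtain ⟨S, hS, hlog, hbound⟩ := exists_hasSum_log_one_sub_mul_pow hx htx
  have hseries : ∑' k : ℕ, t ^ (k + 1) / ((k : ℂ) + 1) * (x ^ (k + 1) / (1 - x ^ (k + 1))) = S := by
    rw [← hS.tsum_eq]
    exact tsum_congr fun k ↦ by ring
  have hne (j : ℕ) : 1 - t * x ^ (j + 1) ≠ 0 := by
    rw [sub_ne_zero]
    intro h
    have hle : ‖t * x * x ^ j‖ < 1 := by
      rw [norm_mul, norm_pow]
      exact (mul_le_of_le_one_right (norm_nonneg _)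
        (pow_le_one₀ (norm_nonneg x) hx.le)).trans_lt htx
    rw [mul_assoc, ← pow_succ', ← h, norm_one] at hle
    exact lt_irrefl _ hle
  have hprod : ∏' n : ℕ, (1 - t * x ^ (n + 1)) = Complex.exp (-S) := by
    refine (Complex.hasProd_of_hasSum_log hne ?_).tprod_eq
    simpa only [neg_neg, mul_assoc, ← pow_succ'] using hlog.neg
  have hre := abs_le.mp ((Complex.abs_re_le_norm S).trans hbound)
  rw [hseries, hprod, Complex.norm_exp, Real.rpow_def_of_pos h1z, Real.rpow_def_of_pos h1z,
    Real.exp_le_exp, Real.exp_le_exp, Complex.neg_re]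
  refine ⟨hbound, ?_, ?_⟩
  · calc
      _ = -(-Real.log (1 - ‖t * x‖) / (1 - ‖x‖)) := by ring
      _ ≤ _ := neg_le_neg hre.2
  · calc
      _ ≤ -Real.log (1 - ‖t * x‖) / (1 - ‖x‖) := neg_le.mp hre.1
      _ = _ := by ring
end

section
/- For every real x with 0 ≤ x < 1, one has 1 ≤ 1/(1-x) ≤ ∑_{k=1}^∞ x^{k-1}/(1 - x^k)² ≤ 1/(1-x)³. -/
/-- Lemma 2.2, bound on S': For real `0 ≤ x < 1`,
`1 ≤ 1/(1-x) ≤ ∑_{k=1}^∞ x^{k-1}/(1-x^k)² ≤ 1/(1-x)³`. -/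
theorem stmt3 (x : ℝ) (hx0 : 0 ≤ x) (hx1 : x < 1) :
    (1 : ℝ) ≤ 1 / (1 - x) ∧
    1 / (1 - x) ≤ (∑' k : ℕ, x ^ k / (1 - x ^ (k + 1)) ^ 2) ∧
    (∑' k : ℕ, x ^ k / (1 - x ^ (k + 1)) ^ 2) ≤ 1 / (1 - x) ^ 3 := by
  have hpos : 0 < 1 - x := sub_pos.2 hx1
  have hden (k : ℕ) : 1 - x ≤ 1 - x ^ (k + 1) :=
    sub_le_sub_left (pow_le_of_le_one hx0 hx1.le k.succ_ne_zero) 1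
  have hlower (k : ℕ) : x ^ k ≤ x ^ k / (1 - x ^ (k + 1)) ^ 2 := by
    have hk : 0 < 1 - x ^ (k + 1) := hpos.trans_le (hden k)
    refine le_div_self (pow_nonneg hx0 k) (by positivity) (pow_le_one₀ hk.le ?_)
    exact sub_le_self 1 (pow_nonneg hx0 _)
  have hupper (k : ℕ) : x ^ k / (1 - x ^ (k + 1)) ^ 2 ≤ x ^ k / (1 - x) ^ 2 := by
    gcongr
    exact pow_le_of_le_one hx0 hx1.le k.succ_ne_zero
  have hgeom : HasSum (fun k : ℕ => x ^ k) (1 - x)⁻¹ := hasSum_geometric_of_lt_one hx0 hx1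
  have hbound := hgeom.div_const ((1 - x) ^ 2)
  have hsum : Summable fun k : ℕ => x ^ k / (1 - x ^ (k + 1)) ^ 2 :=
    .of_nonneg_of_le (fun k => (pow_nonneg hx0 k).trans (hlower k)) hupper hbound.summable
  refine ⟨(one_le_div hpos).2 (sub_le_self 1 hx0), ?_, ?_⟩
  · rw [one_div]
    exact hasSum_le hlower hgeom hsum.hasSum
  · have heq : 1 / (1 - x) ^ 3 = (1 - x)⁻¹ / (1 - x) ^ 2 := by
      field_simp
    rw [heq]
    exact hasSum_le hupper hsum.hasSum hbound
end

section
/- For every real x with 0 ≤ x < 1, one has 3 ≤ 1/(1-x)² + (2 - x²)/(1-x²)² ≤ T(x) ≤ 1/(1-x)⁵ + (2 - x²)/((1-x)³·(1-x²)²) ≤ 3/(1-x)⁵, where T(x) = 2/(1-x)³ + ∑_{k=2}^∞ ((k-1)·x^{k-2} + (k+1)·x^{2k-2})/(1 - x^k)³. -/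
/-- The series of the numerators of `T` is a combination of two arithmetico-geometric series. -/
theorem hasSum_numerators {x : ℝ} (hx0 : 0 ≤ x) (hx1 : x < 1) :
    HasSum (fun n : ℕ => ((n : ℝ) + 1) * x ^ n + ((n : ℝ) + 3) * x ^ (2 * n + 2))
      (1 / (1 - x) ^ 2 + (2 - x ^ 2) / (1 - x ^ 2) ^ 2 - 2) := by
  have hy1 : x ^ 2 < 1 := by nlinarith
  have hx : ‖x‖ < 1 := by rwa [Real.norm_of_nonneg hx0]
  have hy : ‖x ^ 2‖ < 1 := by rwa [Real.norm_of_nonneg (sq_nonneg x)]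
  have hsum := ((hasSum_coe_mul_geometric_of_norm_lt_one hx).add
    (hasSum_geometric_of_norm_lt_one hx)).add
    (((hasSum_coe_mul_geometric_of_norm_lt_one hy).mul_left (x ^ 2)).add
      ((hasSum_geometric_of_norm_lt_one hy).mul_left (3 * x ^ 2)))
  have hx' : 1 - x ≠ 0 := by linarith
  have hy' : 1 - x ^ 2 ≠ 0 := by linarith
  have h1 : x / (1 - x) ^ 2 + (1 - x)⁻¹ = 1 / (1 - x) ^ 2 := by
    field_simp
    ring
  have h2 : x ^ 2 * (x ^ 2 / (1 - x ^ 2) ^ 2) + 3 * x ^ 2 * (1 - x ^ 2)⁻¹ =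
      (2 - x ^ 2) / (1 - x ^ 2) ^ 2 - 2 := by
    field_simp
    ring
  rw [h1, h2, ← add_sub_assoc] at hsum
  have hfun (n : ℕ) : ((n : ℝ) + 1) * x ^ n + ((n : ℝ) + 3) * x ^ (2 * n + 2) =
      n * x ^ n + x ^ n + (x ^ 2 * (n * (x ^ 2) ^ n) + 3 * x ^ 2 * (x ^ 2) ^ n) := by
    rw [pow_add, pow_mul]
    ring
  simpa only [hfun] using hsum


/-- Lemma 2.2, bound on S'': For real `0 ≤ x < 1`, with
`T(x) = 2/(1-x)³ + ∑_{k=2}^∞ ((k-1)x^{k-2} + (k+1)x^{2k-2})/(1-x^k)³`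
(the sum over `k ≥ 2` is written below with `k = n + 2`),
`3 ≤ 1/(1-x)² + (2-x²)/(1-x²)² ≤ T(x) ≤ 1/(1-x)⁵ + (2-x²)/((1-x)³(1-x²)²) ≤ 3/(1-x)⁵`. -/
theorem stmt4 (x : ℝ) (hx0 : 0 ≤ x) (hx1 : x < 1) :
    let T : ℝ := 2 / (1 - x) ^ 3 +
      ∑' n : ℕ, (((n : ℝ) + 1) * x ^ n + ((n : ℝ) + 3) * x ^ (2 * n + 2)) /
        (1 - x ^ (n + 2)) ^ 3
    (3 : ℝ) ≤ 1 / (1 - x) ^ 2 + (2 - x ^ 2) / (1 - x ^ 2) ^ 2 ∧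
    1 / (1 - x) ^ 2 + (2 - x ^ 2) / (1 - x ^ 2) ^ 2 ≤ T ∧
    T ≤ 1 / (1 - x) ^ 5 + (2 - x ^ 2) / ((1 - x) ^ 3 * (1 - x ^ 2) ^ 2) ∧
    1 / (1 - x) ^ 5 + (2 - x ^ 2) / ((1 - x) ^ 3 * (1 - x ^ 2) ^ 2) ≤ 3 / (1 - x) ^ 5 := by
  intro T
  have hx' : 0 < 1 - x := by linarith
  have hy' : 0 < 1 - x ^ 2 := by nlinarith
  have hN := hasSum_numerators hx0 hx1
  have hnum (n : ℕ) : 0 ≤ ((n : ℝ) + 1) * x ^ n + ((n : ℝ) + 3) * x ^ (2 * n + 2) := by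
    positivity
  have hpow (n : ℕ) : x ^ (n + 2) ≤ x := pow_le_of_le_one hx0 hx1.le (by omega)
  have hden_lower (n : ℕ) : (1 - x) ^ 3 ≤ (1 - x ^ (n + 2)) ^ 3 :=
    pow_le_pow_left₀ hx'.le (by linarith [hpow n]) 3
  have hden_upper (n : ℕ) : (1 - x ^ (n + 2)) ^ 3 ≤ 1 :=
    pow_le_one₀ (by linarith [hpow n]) (by linarith [pow_nonneg hx0 (n + 2)])
  have hcube : 0 < (1 - x) ^ 3 := pow_pos hx' 3
  have hden_pos (n : ℕ) : 0 < (1 - x ^ (n + 2)) ^ 3 := hcube.trans_le (hden_lower n)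
  have hterm_upper (n : ℕ) :
      (((n : ℝ) + 1) * x ^ n + ((n : ℝ) + 3) * x ^ (2 * n + 2)) / (1 - x ^ (n + 2)) ^ 3 ≤
        (((n : ℝ) + 1) * x ^ n + ((n : ℝ) + 3) * x ^ (2 * n + 2)) / (1 - x) ^ 3 :=
    div_le_div_of_nonneg_left (hnum n) hcube (hden_lower n)
  have hN' := hN.div_const ((1 - x) ^ 3)
  have hs : Summable fun n : ℕ =>
      (((n : ℝ) + 1) * x ^ n + ((n : ℝ) + 3) * x ^ (2 * n + 2)) / (1 - x ^ (n + 2)) ^ 3 :=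
    Summable.of_nonneg_of_le (fun n => div_nonneg (hnum n) (hden_pos n).le) hterm_upper
      hN'.summable
  have hlower := hasSum_le
    (fun n => le_div_self (hnum n) (hden_pos n) (hden_upper n)) hN hs.hasSum
  have hupper := hasSum_le hterm_upper hs.hasSum hN'
  refine ⟨?_, ?_, ?_, ?_⟩
  · have h1 : 1 ≤ 1 / (1 - x) ^ 2 := by
      rw [le_div_iff₀ (pow_pos hx' 2)]
      nlinarith
    have h2 : 2 ≤ (2 - x ^ 2) / (1 - x ^ 2) ^ 2 := by
      rw [le_div_iff₀ (pow_pos hy' 2)]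
      nlinarith [mul_nonneg (sq_nonneg x) hy'.le, sq_nonneg x]
    linarith
  · have h1 : 2 ≤ 2 / (1 - x) ^ 3 :=
      le_div_self zero_le_two hcube (pow_le_one₀ hx'.le (by linarith))
    linarith
  · have h1 : 1 / (1 - x) ^ 5 + (2 - x ^ 2) / ((1 - x) ^ 3 * (1 - x ^ 2) ^ 2) =
        2 / (1 - x) ^ 3 +
          (1 / (1 - x) ^ 2 + (2 - x ^ 2) / (1 - x ^ 2) ^ 2 - 2) / (1 - x) ^ 3 := by
      have := hx'.ne'
      have := hy'.ne'
      field_simp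
      ring
    rw [h1]
    exact add_le_add_right hupper _
  · have h1 : (2 - x ^ 2) / ((1 - x) ^ 3 * (1 - x ^ 2) ^ 2) ≤ 2 / (1 - x) ^ 5 := by
      have hfactor : (1 - x) ^ 3 * (1 - x ^ 2) ^ 2 = (1 - x) ^ 5 * (1 + x) ^ 2 := by ring
      rw [hfactor, div_le_div_iff₀ (by positivity) (by positivity)]
      have h2 : 2 - x ^ 2 ≤ 2 * (1 + x) ^ 2 := by nlinarith
      nlinarith [mul_le_mul_of_nonneg_right h2 (pow_pos hx' 5).le]
    have h3 : 3 / (1 - x) ^ 5 = 1 / (1 - x) ^ 5 + 2 / (1 - x) ^ 5 := by ring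
    linarith
end

section
/- For every real z > 0, f(z) = f(1/z). -/
/-- `f(z) = log ∏_{n=1}^∞ (1 - e^{-2πnz}) + π/(12z) - (1/4) log(1 + 1/z²)`. -/
noncomputable def f (z : ℝ) : ℝ :=
  Real.log (∏' n : ℕ, (1 - Real.exp (-2 * Real.pi * ((n : ℝ) + 1) * z))) +
    Real.pi / (12 * z) - (1 / 4) * Real.log (1 + 1 / z ^ 2)

open ModularForm in
/-- On the imaginary axis, the norm of the Dedekind eta function is `e^{-πt/12} ∏ (1 - e^{-2πnt})`. -/
lemma norm_eta_I_mul {t : ℝ} (ht : 0 < t) :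
    ‖eta (Complex.I * t)‖ = Real.exp (-(Real.pi * t / 12)) *
      ∏' n : ℕ, (1 - Real.exp (-2 * Real.pi * ((n : ℝ) + 1) * t)) := by
  have hmem : Complex.I * t ∈ UpperHalfPlane.upperHalfPlaneSet := by
    simpa [UpperHalfPlane.upperHalfPlaneSet] using ht
  have hmul := multipliableLocallyUniformlyOn_eta.multipliable hmem
  rw [eta, norm_mul, hmul.norm_tprod]
  congr 1
  · rw [Function.Periodic.qParam, Complex.norm_exp]
    congr 1
    have : 2 * Real.pi * Complex.I * (Complex.I * t) / (24 : ℝ) =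
        ((-(Real.pi * t / 12) : ℝ) : ℂ) := by
      push_cast
      linear_combination (2 * Real.pi * t / 24 : ℂ) * Complex.I_mul_I
    rw [this, Complex.ofReal_re]
  · refine tprod_congr fun n ↦ ?_
    have : 1 - eta_q n (Complex.I * t) =
        ((1 - Real.exp (-2 * Real.pi * ((n : ℝ) + 1) * t) : ℝ) : ℂ) := by
      rw [eta_q_eq_cexp]
      push_cast
      congr 2
      linear_combination (2 * Real.pi * (n + 1) * t : ℂ) * Complex.I_mul_I
    rw [this, Complex.norm_real, Real.norm_of_nonneg]
    have : -2 * Real.pi * ((n : ℝ) + 1) * t ≤ 0 := by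
      have : 0 ≤ Real.pi * ((n : ℝ) + 1) * t := by positivity
      linarith
    linarith [Real.exp_le_one_iff.mpr this]

open ModularForm in
/-- The transformation `|η(i/t)| = √t |η(it)|` of the Dedekind eta function. -/
lemma norm_eta_I_mul_inv {t : ℝ} (ht : 0 < t) :
    ‖eta (Complex.I * (1 / t : ℝ))‖ = t ^ (1 / 2 : ℝ) * ‖eta (Complex.I * t)‖ := by
  have hmem : Complex.I * t ∈ UpperHalfPlane.upperHalfPlaneSet := by
    simpa [UpperHalfPlane.upperHalfPlaneSet] using ht
  have hnorm (w : ℂ) : ‖Complex.sqrt w‖ = ‖w‖ ^ (1 / 2 : ℝ) := by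
    rw [Complex.sqrt, ← Complex.norm_cpow_real]
    simp
  have h := congrArg norm (eta_comp_eq_csqrt_I_inv hmem)
  have harg : -1 / (Complex.I * t) = Complex.I * (1 / t : ℝ) := by
    have : (t : ℂ) ≠ 0 := by exact_mod_cast ht.ne'
    push_cast
    field_simp
    simp
  simpa [harg, hnorm, abs_of_pos ht] using h

open ModularForm in
lemma log_norm_eta_I_mul {t : ℝ} (ht : 0 < t) :
    Real.log ‖eta (Complex.I * t)‖ = -(Real.pi * t / 12) +
      Real.log (∏' n : ℕ, (1 - Real.exp (-2 * Real.pi * ((n : ℝ) + 1) * t))) := by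
  have hne : eta (Complex.I * t) ≠ 0 :=
    eta_ne_zero (by simpa [UpperHalfPlane.upperHalfPlaneSet] using ht)
  have h := norm_eta_I_mul ht
  rw [h, Real.log_mul (Real.exp_pos _).ne' (right_ne_zero_of_mul (h ▸ norm_ne_zero_iff.mpr hne)),
    Real.log_exp]

/-- Proposition 2.3(a): for every real `z > 0`, `f(z) = f(1/z)`. -/
theorem stmt5 (z : ℝ) (hz : 0 < z) : f z = f (1 / z) := by
  have hne : ModularForm.eta (Complex.I * z) ≠ 0 :=
    ModularForm.eta_ne_zero (by simpa [UpperHalfPlane.upperHalfPlaneSet] using hz)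
  have h := congrArg Real.log (norm_eta_I_mul_inv hz)
  rw [Real.log_mul (Real.rpow_pos_of_pos hz _).ne' (norm_ne_zero_iff.mpr hne), Real.log_rpow hz,
    log_norm_eta_I_mul hz, log_norm_eta_I_mul (one_div_pos.mpr hz)] at h
  have hlog : Real.log (1 + 1 / (1 / z) ^ 2) = 2 * Real.log z + Real.log (1 + 1 / z ^ 2) := by
    have : 1 + 1 / (1 / z) ^ 2 = z ^ 2 * (1 + 1 / z ^ 2) := by
      field_simp
      ring
    rw [this, Real.log_mul (by positivity) (by positivity), Real.log_pow]
    push_cast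
    ring
  have hpi : Real.pi / (12 * (1 / z)) = Real.pi * z / 12 := by field_simp
  have hpi' : Real.pi * (1 / z) / 12 = Real.pi / (12 * z) := by field_simp
  rw [hpi'] at h
  rw [f, f, hlog, hpi]
  linarith
end

section
/- The function f satisfies lim_{z→0⁺} f(z) = 0 and lim_{z→+∞} f(z) = 0, and for every real z > 0 one has 0 < f(z) ≤ f(1), where f(1) = log ∏_{n=1}^∞ (1 - e^{-2πn}) + π/12 - (1/4)·log 2. -/
open Filter Topology

/-- The Euler product `∏_{n ≥ 1} (1 - e^{-2πnz})` at a real point. -/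
noncomputable def eulerProd (z : ℝ) : ℝ :=
  ∏' n : ℕ, (1 - Real.exp (-2 * Real.pi * ((n : ℝ) + 1) * z))

theorem f_eq_log_eulerProd (z : ℝ) :
    f z = Real.log (eulerProd z) + Real.pi / (12 * z) - (1 / 4) * Real.log (1 + 1 / z ^ 2) :=
  rfl

theorem exp_eq_pow (n : ℕ) (z : ℝ) :
    Real.exp (-2 * Real.pi * ((n : ℝ) + 1) * z) = Real.exp (-2 * Real.pi * z) ^ (n + 1) := by
  rw [← Real.exp_nat_mul]
  congr 1
  push_cast
  ring

theorem summable_exp {z : ℝ} (hz : 0 < z) :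
    Summable fun n : ℕ ↦ Real.exp (-2 * Real.pi * ((n : ℝ) + 1) * z) := by
  simp_rw [exp_eq_pow]
  refine (summable_nat_add_iff 1).mpr (summable_geometric_of_lt_one (Real.exp_pos _).le ?_)
  rw [Real.exp_lt_one_iff]
  nlinarith [mul_pos Real.pi_pos hz]

theorem one_sub_exp_pos {z : ℝ} (hz : 0 < z) (n : ℕ) :
    0 < 1 - Real.exp (-2 * Real.pi * ((n : ℝ) + 1) * z) := by
  rw [sub_pos, Real.exp_lt_one_iff]
  have : 0 < Real.pi * ((n : ℝ) + 1) * z := by positivity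
  nlinarith

theorem summable_log_one_sub_exp {z : ℝ} (hz : 0 < z) :
    Summable fun n : ℕ ↦ Real.log (1 - Real.exp (-2 * Real.pi * ((n : ℝ) + 1) * z)) := by
  simpa [sub_eq_add_neg] using Real.summable_log_one_add_of_summable (summable_exp hz).neg

theorem exp_tsum_log_eq_eulerProd {z : ℝ} (hz : 0 < z) :
    Real.exp (∑' n : ℕ, Real.log (1 - Real.exp (-2 * Real.pi * ((n : ℝ) + 1) * z))) =
      eulerProd z :=
  Real.rexp_tsum_eq_tprod (one_sub_exp_pos hz) (summable_log_one_sub_exp hz)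

theorem eulerProd_pos {z : ℝ} (hz : 0 < z) : 0 < eulerProd z := by
  rw [← exp_tsum_log_eq_eulerProd hz]
  exact Real.exp_pos _

theorem log_eulerProd {z : ℝ} (hz : 0 < z) :
    Real.log (eulerProd z) =
      ∑' n : ℕ, Real.log (1 - Real.exp (-2 * Real.pi * ((n : ℝ) + 1) * z)) := by
  rw [← exp_tsum_log_eq_eulerProd hz, Real.log_exp]

theorem tendsto_eulerProd_atTop : Tendsto eulerProd atTop (𝓝 1) := by
  have h := tendsto_tprod_one_add_of_dominated_convergence (𝓕 := (atTop : Filter ℝ))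
    (g := fun _ : ℕ ↦ (0 : ℝ))
    (f := fun (z : ℝ) (n : ℕ) ↦ -Real.exp (-2 * Real.pi * ((n : ℝ) + 1) * z))
    (bound := fun n : ℕ ↦ Real.exp (-2 * Real.pi * ((n : ℝ) + 1) * 1))
    (summable_exp one_pos) ?_ ?_
  · simp only [← sub_eq_add_neg, add_zero, tprod_one] at h
    exact h
  · intro k
    rw [← neg_zero]
    refine (Real.tendsto_exp_atBot.comp ?_).neg
    refine tendsto_id.const_mul_atTop_of_neg ?_
    have : 0 < Real.pi * ((k : ℝ) + 1) := by positivity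
    linarith
  · filter_upwards [eventually_ge_atTop 1] with z hz k
    rw [norm_neg, Real.norm_of_nonneg (Real.exp_pos _).le, Real.exp_le_exp]
    have : 0 < Real.pi * ((k : ℝ) + 1) := by positivity
    nlinarith

theorem tendsto_f_atTop : Tendsto f atTop (𝓝 0) := by
  have h1 : Tendsto (fun z ↦ Real.log (eulerProd z)) atTop (𝓝 0) := by
    rw [← Real.log_one]
    exact (Real.continuousAt_log one_ne_zero).tendsto.comp tendsto_eulerProd_atTop
  have h2 : Tendsto (fun z : ℝ ↦ Real.pi / (12 * z)) atTop (𝓝 0) :=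
    (tendsto_id.const_mul_atTop (by norm_num)).const_div_atTop _
  have h3 : Tendsto (fun z : ℝ ↦ (1 / 4) * Real.log (1 + 1 / z ^ 2)) atTop (𝓝 0) := by
    have h : Tendsto (fun z : ℝ ↦ 1 + 1 / z ^ 2) atTop (𝓝 1) := by
      simpa using ((tendsto_pow_atTop two_ne_zero).const_div_atTop (1 : ℝ)).const_add 1
    rw [← mul_zero (1 / 4), ← Real.log_one]
    exact ((Real.continuousAt_log one_ne_zero).tendsto.comp h).const_mul (1 / 4)
  have h := (h1.add h2).sub h3
  rw [add_zero, sub_zero] at h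
  exact h

theorem eta_I_mul {z : ℝ} (hz : 0 < z) :
    ModularForm.eta (Complex.I * z) =
      ((Real.exp (-(Real.pi * z / 12)) * eulerProd z : ℝ) : ℂ) := by
  have hm : Multipliable fun n : ℕ ↦ 1 - Real.exp (-2 * Real.pi * ((n : ℝ) + 1) * z) :=
    Real.multipliable_of_summable_log (one_sub_exp_pos hz) (summable_log_one_sub_exp hz)
  have hp : ((eulerProd z : ℝ) : ℂ) =
      ∏' n : ℕ, (1 - ModularForm.eta_q n (Complex.I * z)) := by
    have h := hm.map_tprod Complex.ofRealHom Complex.continuous_ofReal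
    rw [eulerProd]
    refine h.trans (tprod_congr fun n ↦ ?_)
    rw [ModularForm.eta_q_eq_cexp]
    simp only [Complex.ofRealHom_eq_coe]
    push_cast
    congr 2
    linear_combination (-2 * Real.pi * ((n : ℂ) + 1) * z) * Complex.I_sq
  rw [ModularForm.eta, ← hp, Complex.ofReal_mul, Function.Periodic.qParam]
  push_cast
  congr 2
  linear_combination (Real.pi * z / 12) * Complex.I_sq

theorem eulerProd_inv {z : ℝ} (hz : 0 < z) :
    Real.exp (-(Real.pi * z⁻¹ / 12)) * eulerProd z⁻¹ =
      √z * (Real.exp (-(Real.pi * z / 12)) * eulerProd z) := by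
  have h := ModularForm.eta_comp_eq_csqrt_I_inv (x := Complex.I * z)
    (by simpa [UpperHalfPlane.upperHalfPlaneSet] using hz)
  have hI : (-1 : ℂ) / (Complex.I * z) = Complex.I * ((z⁻¹ : ℝ) : ℂ) := by
    have hz' : (z : ℂ) ≠ 0 := by exact_mod_cast hz.ne'
    push_cast
    field_simp
    simp
  simp only [Function.comp_apply, Pi.smul_apply, Pi.mul_apply, hI, smul_eq_mul, eta_I_mul hz,
    eta_I_mul (inv_pos.mpr hz)] at h
  have hs : (Complex.sqrt Complex.I)⁻¹ * Complex.sqrt (Complex.I * z) = ((√z : ℝ) : ℂ) := by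
    have hz' : (z : ℂ) ≠ 0 := by exact_mod_cast hz.ne'
    have hsI : Complex.sqrt Complex.I ≠ 0 := by simp [Complex.sqrt]
    rw [inv_mul_eq_iff_eq_mul₀ hsI, mul_comm Complex.I, Complex.sqrt, Complex.sqrt,
      Complex.cpow_def_of_ne_zero (mul_ne_zero hz' Complex.I_ne_zero),
      Complex.log_ofReal_mul hz Complex.I_ne_zero, add_mul, Complex.exp_add,
      Complex.cpow_def_of_ne_zero Complex.I_ne_zero, mul_comm, Real.sqrt_eq_rpow,
      Real.rpow_def_of_pos hz]
    push_cast
    norm_num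
  rw [← mul_assoc, hs] at h
  exact_mod_cast h

theorem log_eulerProd_inv {z : ℝ} (hz : 0 < z) :
    Real.log (eulerProd z⁻¹) = Real.log (eulerProd z) + Real.log z / 2 +
      Real.pi * z⁻¹ / 12 - Real.pi * z / 12 := by
  have h := congrArg Real.log (eulerProd_inv hz)
  have h1 := (eulerProd_pos hz).ne'
  have h2 := (eulerProd_pos (inv_pos.mpr hz)).ne'
  rw [Real.log_mul (Real.exp_ne_zero _) h2, Real.log_mul (Real.sqrt_pos.mpr hz).ne'
    (mul_ne_zero (Real.exp_ne_zero _) h1), Real.log_mul (Real.exp_ne_zero _) h1, Real.log_exp,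
    Real.log_exp, Real.log_sqrt hz.le] at h
  linarith

theorem f_inv {z : ℝ} (hz : 0 < z) : f z⁻¹ = f z := by
  have h : Real.log (1 + 1 / z ^ 2) = Real.log (1 + z ^ 2) - 2 * Real.log z := by
    rw [show 1 + 1 / z ^ 2 = (1 + z ^ 2) / z ^ 2 by field_simp; ring,
      Real.log_div (by positivity) (by positivity), Real.log_pow]
    push_cast
    ring
  rw [f_eq_log_eulerProd, f_eq_log_eulerProd, log_eulerProd_inv hz, h]
  simp only [inv_pow, one_div, inv_inv]
  field_simp
  ring

theorem tendsto_f_nhdsGT_zero : Tendsto f (𝓝[>] 0) (𝓝 0) := by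
  refine (tendsto_f_atTop.comp tendsto_inv_nhdsGT_zero).congr' ?_
  filter_upwards [self_mem_nhdsWithin] with z hz using f_inv hz

theorem differentiableAt_eulerProd {z : ℝ} (hz : 0 < z) : DifferentiableAt ℝ eulerProd z := by
  have hη : DifferentiableAt ℂ (fun w ↦ ModularForm.eta (Complex.I * w)) (z : ℂ) :=
    (ModularForm.differentiableAt_eta_of_mem_upperHalfPlaneSet
      (z := Complex.I * z) (by simpa [UpperHalfPlane.upperHalfPlaneSet] using hz)).comp
      (z : ℂ) (by fun_prop)
  have h := hη.hasDerivAt.real_of_complex.differentiableAt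
  have h' : DifferentiableAt ℝ (fun x : ℝ ↦ Real.exp (Real.pi * x / 12) *
      (ModularForm.eta (Complex.I * x)).re) z := by
    exact (by fun_prop : DifferentiableAt ℝ (fun x : ℝ ↦ Real.exp (Real.pi * x / 12)) z).mul h
  refine h'.congr_of_eventuallyEq ?_
  filter_upwards [lt_mem_nhds hz] with x hx
  rw [eta_I_mul hx, Complex.ofReal_re, ← mul_assoc, ← Real.exp_add]
  simp

theorem differentiableAt_f {z : ℝ} (hz : 0 < z) : DifferentiableAt ℝ f z := by
  have h1 := (differentiableAt_eulerProd hz).log (eulerProd_pos hz).ne'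
  have h2 : DifferentiableAt ℝ (fun z : ℝ ↦ Real.pi / (12 * z)) z := by
    fun_prop (disch := positivity)
  have h3 : DifferentiableAt ℝ (fun z : ℝ ↦ (1 / 4) * Real.log (1 + 1 / z ^ 2)) z := by
    fun_prop (disch := positivity)
  exact (h1.add h2).sub h3

theorem hasDerivAt_f_one : HasDerivAt f 0 1 := by
  have h := (differentiableAt_f one_pos).hasDerivAt
  have hi : HasDerivAt (fun z : ℝ ↦ f z⁻¹) (deriv f 1 * -1) 1 := by
    have h' : HasDerivAt f (deriv f 1) ((1 : ℝ)⁻¹) := by simpa using h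
    exact (h'.comp (1 : ℝ) (hasDerivAt_inv one_ne_zero)).congr_deriv (by simp)
  have hi' : HasDerivAt f (deriv f 1 * -1) 1 := by
    refine hi.congr_of_eventuallyEq ?_
    filter_upwards [lt_mem_nhds one_pos] with z hz using (f_inv hz).symm
  have := h.unique hi'
  have h0 : deriv f 1 = 0 := by linarith
  rwa [h0] at h

theorem concaveOn_log_one_sub_exp_neg_div {a : ℝ} (ha : 2 ≤ a) :
    ConcaveOn ℝ (Set.Ioc 0 1) fun w : ℝ ↦ Real.log (1 - Real.exp (-(a / w))) := by
  have hpos : ∀ w : ℝ, 0 < w → 0 < 1 - Real.exp (-(a / w)) := fun w hw ↦ by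
    rw [sub_pos, Real.exp_lt_one_iff]
    have : 0 < a / w := by positivity
    linarith
  have hpos' : ∀ w : ℝ, 0 < w → 0 < Real.exp (a / w) - 1 := fun w hw ↦ by
    rw [sub_pos, Real.one_lt_exp_iff]
    positivity
  have hderiv : ∀ w : ℝ, 0 < w → HasDerivAt (fun w : ℝ ↦ Real.log (1 - Real.exp (-(a / w))))
      (-(a / (w ^ 2 * (Real.exp (a / w) - 1)))) w := fun w hw ↦ by
    have h1 : HasDerivAt (fun w : ℝ ↦ -(a / w)) (a / w ^ 2) w := by
      refine ((hasDerivAt_inv hw.ne').const_mul a).neg.congr_deriv ?_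
      field_simp
    have h2 := (h1.exp.const_sub 1).log (hpos w hw).ne'
    refine h2.congr_deriv ?_
    have h3 := (hpos w hw).ne'
    have h4 := (hpos' w hw).ne'
    rw [Real.exp_neg] at h3 ⊢
    have h5 := Real.exp_ne_zero (a / w)
    have h6 : 1 - (Real.exp (a / w))⁻¹ = (Real.exp (a / w) - 1) / Real.exp (a / w) := by
      field_simp
    rw [h6]
    field_simp
  refine AntitoneOn.concaveOn_of_deriv (convex_Ioc 0 1)
    (fun w hw ↦ (hderiv w hw.1).continuousAt.continuousWithinAt) ?_ ?_
  · rw [interior_Ioc]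
    exact fun w hw ↦ (hderiv w hw.1).differentiableAt.differentiableWithinAt
  · rw [interior_Ioc]
    intro v hv w hw hvw
    rw [(hderiv v hv.1).deriv, (hderiv w hw.1).deriv, neg_le_neg_iff]
    have hv0 := hv.1
    have hw0 := hw.1
    have hEw := hpos' w hw.1
    refine div_le_div_of_nonneg_left (by linarith) (mul_pos (by positivity) hEw) ?_
    have hsplit : Real.exp (a / v) = Real.exp ((a / v - a / w) / 2) ^ 2 * Real.exp (a / w) := by
      rw [← Real.exp_nat_mul, ← Real.exp_add]
      congr 1
      push_cast
      ring
    have hd : 0 ≤ (a / v - a / w) / 2 := by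
      have : a / w ≤ a / v := div_le_div_of_nonneg_left (by linarith) hv0 hvw
      linarith
    have hratio : w ≤ v * Real.exp ((a / v - a / w) / 2) := by
      have h1 : (a / v - a / w) / 2 + 1 ≤ Real.exp ((a / v - a / w) / 2) := Real.add_one_le_exp _
      have h2 : w ≤ v * ((a / v - a / w) / 2 + 1) := by
        have h3 : v * ((a / v - a / w) / 2 + 1) = v + a * (w - v) / (2 * w) := by
          field_simp
          ring
        have h4 : w - v ≤ a * (w - v) / (2 * w) := by
          rw [le_div_iff₀ (by positivity)]
          have hw1 := hw.2
          nlinarith [mul_nonneg (sub_nonneg.mpr hvw) (by linarith : 0 ≤ a - 2 * w)]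
        linarith
      exact h2.trans (mul_le_mul_of_nonneg_left h1 hv0.le)
    have h1 : (1 : ℝ) ≤ Real.exp ((a / v - a / w) / 2) := Real.one_le_exp hd
    set c := Real.exp ((a / v - a / w) / 2)
    calc w ^ 2 * (Real.exp (a / w) - 1) ≤ (v * c) ^ 2 * (Real.exp (a / w) - 1) := by gcongr
      _ = v ^ 2 * (c ^ 2 * Real.exp (a / w) - c ^ 2) := by ring
      _ ≤ v ^ 2 * (Real.exp (a / v) - 1) := by
        rw [hsplit]
        gcongr
        nlinarith

theorem concaveOn_tsum {ι : Type*} {s : Set ℝ} {g : ι → ℝ → ℝ} (hs : Convex ℝ s)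
    (hg : ∀ i, ConcaveOn ℝ s (g i)) (hsum : ∀ x ∈ s, Summable fun i ↦ g i x) :
    ConcaveOn ℝ s fun x ↦ ∑' i, g i x := by
  refine ⟨hs, fun x hx y hy a b ha hb hab ↦ ?_⟩
  simp only [smul_eq_mul]
  have hx' := (hsum x hx).mul_left a
  have hy' := (hsum y hy).mul_left b
  rw [← tsum_mul_left, ← tsum_mul_left, ← hx'.tsum_add hy']
  exact (hx'.add hy').tsum_le_tsum (fun i ↦ (hg i).2 hx hy ha hb hab)
    (hsum _ (hs hx hy ha hb hab))

theorem concaveOn_log_eulerProd_inv :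
    ConcaveOn ℝ (Set.Ioc 0 1) fun w ↦ Real.log (eulerProd w⁻¹) := by
  have h := concaveOn_tsum (convex_Ioc (0 : ℝ) 1)
    (g := fun (n : ℕ) w ↦ Real.log (1 - Real.exp (-(2 * Real.pi * ((n : ℝ) + 1) / w))))
    (fun n ↦ concaveOn_log_one_sub_exp_neg_div ?_) ?_
  · refine h.congr fun w hw ↦ ?_
    simp only [log_eulerProd (inv_pos.mpr hw.1), div_eq_mul_inv, neg_mul]
  · have := Real.pi_gt_three
    have hn : (0 : ℝ) ≤ n := n.cast_nonneg
    nlinarith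
  · intro w hw
    simpa only [div_eq_mul_inv, neg_mul] using summable_log_one_sub_exp (inv_pos.mpr hw.1)

theorem strictConcaveOn_neg_log_one_add_sq :
    StrictConcaveOn ℝ (Set.Ioc 0 1) fun w : ℝ ↦ -Real.log (1 + w ^ 2) := by
  have hderiv : ∀ w : ℝ, HasDerivAt (fun w : ℝ ↦ -Real.log (1 + w ^ 2))
      (-(2 * w / (1 + w ^ 2))) w := fun w ↦ by
    have h := (((hasDerivAt_pow 2 w).const_add 1).log (by positivity)).neg
    refine h.congr_deriv ?_
    simp
  refine StrictAntiOn.strictConcaveOn_of_deriv (convex_Ioc 0 1)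
    (fun w _ ↦ (hderiv w).continuousAt.continuousWithinAt) ?_
  rw [interior_Ioc]
  intro v hv w hw hvw
  rw [(hderiv v).deriv, (hderiv w).deriv, neg_lt_neg_iff, div_lt_div_iff₀ (by positivity)
    (by positivity)]
  have : v * w < 1 := by nlinarith [hv.1, hv.2, hw.1, hw.2]
  nlinarith [mul_pos (sub_pos.mpr hvw) (sub_pos.mpr this)]

theorem strictConcaveOn_f : StrictConcaveOn ℝ (Set.Ioc 0 1) f := by
  have hlin : ConcaveOn ℝ (Set.Ioc 0 1) fun w : ℝ ↦ Real.pi / 12 * w :=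
    (concaveOn_id (convex_Ioc 0 1)).smul (by positivity : 0 ≤ Real.pi / 12)
  have hlog : StrictConcaveOn ℝ (Set.Ioc 0 1) fun w : ℝ ↦ 1 / 4 * -Real.log (1 + w ^ 2) := by
    refine ⟨convex_Ioc 0 1, fun x hx y hy hxy a b ha hb hab ↦ ?_⟩
    have := strictConcaveOn_neg_log_one_add_sq.2 hx hy hxy ha hb hab
    simp only [smul_eq_mul] at this ⊢
    linarith
  refine ((concaveOn_log_eulerProd_inv.add hlin).add_strictConcaveOn hlog).congr fun w hw ↦ ?_
  rw [← f_inv hw.1, f_eq_log_eulerProd]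
  simp only [Pi.add_apply, inv_pow, one_div, inv_inv]
  field_simp
  ring

theorem f_lt_f_one {z : ℝ} (hz : 0 < z) (hz1 : z < 1) : f z < f 1 := by
  have h := strictConcaveOn_f.lt_slope_of_hasDerivAt ⟨hz, hz1.le⟩ ⟨one_pos, le_rfl⟩ hz1
    hasDerivAt_f_one
  rw [slope_def_field, lt_div_iff₀ (by linarith)] at h
  linarith

theorem strictMonoOn_f : StrictMonoOn f (Set.Ioc 0 1) := by
  intro x hx y hy hxy
  rcases hy.2.eq_or_lt with rfl | hy1
  · exact f_lt_f_one hx.1 hxy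
  · have h := strictConcaveOn_f.lt_on_openSegment hx ⟨one_pos, le_rfl⟩ (hxy.trans hy1).ne
      (by rw [openSegment_eq_Ioo (hxy.trans hy1)]; exact ⟨hxy, hy1⟩)
    rwa [min_eq_left (f_lt_f_one hx.1 (hxy.trans hy1)).le] at h

theorem f_pos_of_mem_Ioc {z : ℝ} (hz : z ∈ Set.Ioc 0 1) : 0 < f z := by
  have hz0 : 0 < z := hz.1
  have hhalf : z / 2 ∈ Set.Ioc (0 : ℝ) 1 := ⟨by linarith, by linarith [hz.2]⟩
  have h0 : 0 ≤ f (z / 2) := by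
    refine le_of_tendsto tendsto_f_nhdsGT_zero ?_
    filter_upwards [Ioo_mem_nhdsGT hhalf.1] with t ht
    exact (strictMonoOn_f ⟨ht.1, ht.2.le.trans hhalf.2⟩ hhalf ht.2).le
  exact h0.trans_lt (strictMonoOn_f hhalf hz (by linarith))

theorem f_pos_and_le_f_one {z : ℝ} (hz : 0 < z) : 0 < f z ∧ f z ≤ f 1 := by
  have key : ∀ w ∈ Set.Ioc (0 : ℝ) 1, 0 < f w ∧ f w ≤ f 1 := fun w hw ↦
    ⟨f_pos_of_mem_Ioc hw, strictMonoOn_f.monotoneOn hw ⟨one_pos, le_rfl⟩ hw.2⟩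
  rcases le_total z 1 with h | h
  · exact key z ⟨hz, h⟩
  · rw [← f_inv hz]
    exact key z⁻¹ ⟨inv_pos.mpr hz, inv_le_one_of_one_le₀ h⟩

/-- Proposition 2.3(b,c): `f(z) → 0` as `z → 0⁺` and as `z → +∞`, and
`0 < f(z) ≤ f(1)` for all `z > 0`, where
`f(1) = log ∏_{n=1}^∞ (1 - e^{-2πn}) + π/12 - (1/4) log 2`. -/
theorem stmt6 :
    Filter.Tendsto f (nhdsWithin 0 (Set.Ioi 0)) (nhds 0) ∧
    Filter.Tendsto f Filter.atTop (nhds 0) ∧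
    (∀ z : ℝ, 0 < z → 0 < f z ∧ f z ≤ f 1) ∧
    f 1 = Real.log (∏' n : ℕ, (1 - Real.exp (-2 * Real.pi * ((n : ℝ) + 1)))) +
      Real.pi / 12 - (1 / 4) * Real.log 2 := by
  refine ⟨tendsto_f_nhdsGT_zero, tendsto_f_atTop, fun z hz ↦ f_pos_and_le_f_one hz, ?_⟩
  rw [f]
  norm_num
end

section
/- The function f is differentiable on (0,∞), and its derivative satisfies f'(z) > 0 for 0 < z < 1, f'(1) = 0, and f'(z) < 0 for z > 1; in particular f is strictly increasing on (0,1] and strictly decreasing on [1,∞). -/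
/-- The point `i z` on the positive imaginary axis. -/
noncomputable def imAxis (z : ℝ) (hz : 0 < z) : UpperHalfPlane :=
  ⟨Complex.I * z, by simpa using hz⟩

/-- The real part of `E₂(i z)`. -/
noncomputable def E2ImAxis (z : ℝ) : ℝ :=
  if hz : 0 < z then (EisensteinSeries.E2 (imAxis z hz)).re else 0

lemma E2ImAxis_of_pos {z : ℝ} (hz : 0 < z) :
    E2ImAxis z = (EisensteinSeries.E2 (imAxis z hz)).re := dif_pos hz

/-- The product `∏ (1 - e^{-2πnz})` in terms of the Dedekind eta function. -/
lemma ofReal_tprod_one_sub_exp {z : ℝ} (hz : 0 < z) :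
    ((∏' n : ℕ, (1 - Real.exp (-2 * Real.pi * ((n : ℝ) + 1) * z)) : ℝ) : ℂ) =
      ModularForm.eta (Complex.I * z) * Complex.exp (Real.pi * z / 12) := by
  have hq : Function.Periodic.qParam 24 (Complex.I * z) * Complex.exp (Real.pi * z / 12) = 1 := by
    rw [Function.Periodic.qParam, ← Complex.exp_add, ← Complex.exp_zero]
    congr 1
    have := Complex.I_sq
    push_cast
    linear_combination (Real.pi * z / 12 : ℂ) * this
  have hterm (n : ℕ) : ((1 - Real.exp (-2 * Real.pi * ((n : ℝ) + 1) * z) : ℝ) : ℂ) =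
      1 - ModularForm.eta_q n (Complex.I * z) := by
    rw [ModularForm.eta_q_eq_cexp]
    push_cast
    congr 2
    have := Complex.I_sq
    linear_combination (-2 * Real.pi * (n + 1) * z : ℂ) * this
  have hlt : ‖Complex.exp (-2 * Real.pi * z)‖ < 1 := by
    rw [Complex.norm_exp, Real.exp_lt_one_iff]
    simp
    positivity
  have hm : Multipliable fun n : ℕ ↦ (1 - Real.exp (-2 * Real.pi * ((n : ℝ) + 1) * z)) := by
    simp_rw [sub_eq_add_neg]
    apply Real.multipliable_one_add_of_summable
    have := (summable_nat_add_iff 1).mpr (summable_geometric_of_lt_one (norm_nonneg _) hlt)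
    refine this.neg.congr fun n ↦ ?_
    rw [Complex.norm_exp, ← Real.exp_nat_mul]
    simp
    ring
  have := hm.map_tprod Complex.ofRealHom Complex.continuous_ofReal
  simp only [Complex.ofRealHom_eq_coe] at this
  rw [this, tprod_congr hterm, ModularForm.eta]
  linear_combination (-∏' n : ℕ, (1 - ModularForm.eta_q n (Complex.I * z))) * hq

lemma tprod_one_sub_exp_ne_zero {z : ℝ} (hz : 0 < z) :
    ∏' n : ℕ, (1 - Real.exp (-2 * Real.pi * ((n : ℝ) + 1) * z)) ≠ 0 := by
  rw [← Complex.ofReal_ne_zero, ofReal_tprod_one_sub_exp hz]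
  exact mul_ne_zero (ModularForm.eta_ne_zero (imAxis z hz).2) (Complex.exp_ne_zero _)

lemma hasDerivAt_tprod_one_sub_exp {z : ℝ} (hz : 0 < z) :
    HasDerivAt (fun x : ℝ ↦ ∏' n : ℕ, (1 - Real.exp (-2 * Real.pi * ((n : ℝ) + 1) * x)))
      ((∏' n : ℕ, (1 - Real.exp (-2 * Real.pi * ((n : ℝ) + 1) * z))) *
        (Real.pi / 12 * (1 - E2ImAxis z))) z := by
  have heta := (ModularForm.differentiableAt_eta_of_mem_upperHalfPlaneSet
    (imAxis z hz).2).hasDerivAt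
  have hlog := ModularForm.logDeriv_eta_eq_E2 (imAxis z hz)
  have h0 := ModularForm.eta_ne_zero (imAxis z hz).2
  rw [logDeriv_apply, div_eq_iff h0] at hlog
  rw [show ((imAxis z hz).1 : ℂ) = Complex.I * z from rfl] at heta h0
  rw [show ((imAxis z hz : UpperHalfPlane) : ℂ) = Complex.I * z from rfl] at hlog
  rw [hlog] at heta
  have hI : HasDerivAt (fun w : ℂ ↦ Complex.I * w) Complex.I (z : ℂ) := by
    simpa using (hasDerivAt_id (z : ℂ)).const_mul Complex.I
  have hE : HasDerivAt (fun w : ℂ ↦ Complex.exp (Real.pi * w / 12))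
      (Complex.exp (Real.pi * z / 12) * (Real.pi / 12)) (z : ℂ) := by
    simpa using (((hasDerivAt_id (z : ℂ)).const_mul (Real.pi : ℂ)).div_const 12).cexp
  have hF := ((heta.comp (z : ℂ) hI).mul hE).real_of_complex
  refine (hF.congr_of_eventuallyEq ?_).congr_deriv ?_
  · filter_upwards [lt_mem_nhds hz] with x hx
    have := congrArg Complex.re (ofReal_tprod_one_sub_exp hx)
    simpa using this
  · have hp := ofReal_tprod_one_sub_exp hz
    rw [E2ImAxis_of_pos hz]
    set P := ∏' n : ℕ, (1 - Real.exp (-2 * Real.pi * ((n : ℝ) + 1) * z))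
    have : ∀ E : ℂ, (P * (Real.pi / 12 * (1 - E.re)) : ℝ) =
        ((P : ℂ) * ((Real.pi / 12 : ℝ) * (1 - E))).re := by
      intro E
      rw [Complex.re_ofReal_mul, Complex.re_ofReal_mul]
      simp
    rw [this, hp]
    congr 1
    push_cast
    simp only [Function.comp]
    have := Complex.I_sq
    linear_combination (Real.pi / 12 * EisensteinSeries.E2 (imAxis z hz) *
      ModularForm.eta (Complex.I * z) * Complex.exp (Real.pi * z / 12) : ℂ) * this

lemma hasDerivAt_f {z : ℝ} (hz : 0 < z) :
    HasDerivAt f (Real.pi / 12 * (1 - E2ImAxis z) - Real.pi / (12 * z ^ 2) +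
      1 / (2 * z * (z ^ 2 + 1))) z := by
  have h1 := (hasDerivAt_tprod_one_sub_exp hz).log (tprod_one_sub_exp_ne_zero hz)
  have h2 : HasDerivAt (fun x : ℝ ↦ Real.pi / (12 * x)) _ z :=
    (hasDerivAt_const z Real.pi).div ((hasDerivAt_id z).const_mul 12) (by simp [hz.ne'])
  have h3 : HasDerivAt (fun x : ℝ ↦ (1 / 4) * Real.log (1 + 1 / x ^ 2)) _ z :=
    ((((hasDerivAt_const z (1 : ℝ)).div (hasDerivAt_pow 2 z) (by positivity)).const_add 1).log
      (by simp only [Pi.div_apply]; positivity)).const_mul (1 / 4)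
  refine ((h1.add h2).sub h3).congr_deriv ?_
  rw [mul_div_cancel_left₀ _ (tprod_one_sub_exp_ne_zero hz)]
  simp
  field_simp
  ring

/-- The weight-two transformation law of `E₂` under `z ↦ 1 / z` on the imaginary axis. -/
lemma E2ImAxis_inv {z : ℝ} (hz : 0 < z) :
    E2ImAxis z⁻¹ = -z ^ 2 * E2ImAxis z + 6 * z / Real.pi := by
  have hS : ModularGroup.S • imAxis z hz = imAxis z⁻¹ (inv_pos.mpr hz) := by
    rw [UpperHalfPlane.modular_S_smul]
    ext
    simp [imAxis, mul_comm]
  have h := EisensteinSeries.G2_S_transform (imAxis z hz)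
  rw [hS] at h
  have hz' : (z : ℂ) ≠ 0 := by exact_mod_cast hz.ne'
  have hpi : (Real.pi : ℂ) ≠ 0 := by exact_mod_cast Real.pi_ne_zero
  have h' : EisensteinSeries.E2 (imAxis z⁻¹ (inv_pos.mpr hz)) =
      ((-z ^ 2 : ℝ) : ℂ) * EisensteinSeries.E2 (imAxis z hz) + ((6 * z / Real.pi : ℝ) : ℂ) := by
    rw [show ((imAxis z hz : UpperHalfPlane) : ℂ) = Complex.I * z from rfl] at h
    simp only [EisensteinSeries.E2, Pi.smul_apply, smul_eq_mul, riemannZeta_two, h]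
    push_cast
    field_simp
    rw [Complex.I_sq]
    ring
  rw [E2ImAxis_of_pos hz, E2ImAxis_of_pos (inv_pos.mpr hz), h', Complex.add_re,
    Complex.re_ofReal_mul, Complex.ofReal_re]

lemma hasSum_one_sub_E2ImAxis {z : ℝ} (hz : 0 < z) :
    HasSum (fun n : ℕ ↦ 24 * (ArithmeticFunction.sigma 1 n : ℝ) * Real.exp (-(2 * Real.pi * n * z)))
      (1 - E2ImAxis z) := by
  have h := Complex.hasSum_re (EisensteinSeries.hasSum_qExpansion_E2 (imAxis z hz))
  rw [← E2ImAxis_of_pos hz] at h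
  refine ((hasSum_ite_eq 0 (1 : ℝ)).sub h).congr_fun fun n ↦ ?_
  have hq : Complex.exp (2 * Real.pi * Complex.I * (imAxis z hz : UpperHalfPlane)) ^ n =
      (Real.exp (-(2 * Real.pi * n * z)) : ℝ) := by
    rw [← Complex.exp_nat_mul, show ((imAxis z hz : UpperHalfPlane) : ℂ) = Complex.I * z from rfl]
    push_cast
    congr 1
    have := Complex.I_sq
    linear_combination (2 * Real.pi * n * z : ℂ) * this
  rw [hq]
  rcases eq_or_ne n 0 with rfl | hn
  · simp
  · rw [if_neg hn, if_neg hn, smul_eq_mul, Complex.re_mul_ofReal]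
    simp

/-- The function `z² (1 - E₂(i z))` is strictly decreasing on `[1,∞)`. -/
lemma sq_mul_one_sub_E2ImAxis_lt {a b : ℝ} (ha : 1 ≤ a) (hab : a < b) :
    b ^ 2 * (1 - E2ImAxis b) < a ^ 2 * (1 - E2ImAxis a) := by
  have ha0 : 0 < a := by linarith
  have hexp (n : ℕ) (hn : 1 ≤ n) : b ^ 2 * Real.exp (-(2 * Real.pi * n * b)) <
      a ^ 2 * Real.exp (-(2 * Real.pi * n * a)) := by
    have h1 : b ≤ a * Real.exp (b - a) := by
      nlinarith [Real.add_one_le_exp (b - a)]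
    have hn' : (1 : ℝ) ≤ n := by exact_mod_cast hn
    have h2 : b ^ 2 ≤ a ^ 2 * Real.exp (2 * (b - a)) := by
      calc b ^ 2 ≤ (a * Real.exp (b - a)) ^ 2 := by gcongr; linarith
        _ = _ := by rw [mul_pow, ← Real.exp_nat_mul]; norm_num
    calc b ^ 2 * Real.exp (-(2 * Real.pi * n * b))
        ≤ a ^ 2 * Real.exp (2 * (b - a)) * Real.exp (-(2 * Real.pi * n * b)) := by gcongr
      _ = a ^ 2 * Real.exp (2 * (b - a) + -(2 * Real.pi * n * b)) := by rw [Real.exp_add]; ring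
      _ < _ := by
        gcongr
        have : 1 < Real.pi * n := by nlinarith [Real.pi_gt_three]
        nlinarith
  refine hasSum_lt (i := 1) (fun n ↦ ?_) ?_ ((hasSum_one_sub_E2ImAxis (by linarith)).mul_left _)
    ((hasSum_one_sub_E2ImAxis ha0).mul_left _)
  · rcases Nat.eq_zero_or_pos n with rfl | hn
    · simp
    · have := mul_le_mul_of_nonneg_left (hexp n hn).le
        (by positivity : 0 ≤ 24 * (ArithmeticFunction.sigma 1 n : ℝ))
      linarith
  · have := hexp 1 le_rfl
    simp only [ArithmeticFunction.sigma_one]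
    push_cast at this ⊢
    linarith

lemma E2ImAxis_one : E2ImAxis 1 = 3 / Real.pi := by
  have := E2ImAxis_inv one_pos
  rw [inv_one] at this
  linear_combination this / 2

lemma deriv_f_neg {z : ℝ} (hz : 1 < z) : deriv f z < 0 := by
  have hz0 : 0 < z := by linarith
  rw [(hasDerivAt_f hz0).deriv]
  have h := sq_mul_one_sub_E2ImAxis_lt le_rfl hz
  rw [E2ImAxis_one] at h
  have hpi := Real.pi_pos
  have hfrac : z / (2 * (z ^ 2 + 1)) < 1 / 4 := by
    rw [div_lt_div_iff₀ (by positivity) (by positivity)]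
    nlinarith [sq_pos_of_pos (sub_pos.mpr hz)]
  have h' : Real.pi / 12 * (z ^ 2 * (1 - E2ImAxis z)) < Real.pi / 12 - 1 / 4 := by
    calc _ < Real.pi / 12 * (1 ^ 2 * (1 - 3 / Real.pi)) := by gcongr
      _ = _ := by field_simp; ring
  have key : z ^ 2 * (Real.pi / 12 * (1 - E2ImAxis z) - Real.pi / (12 * z ^ 2) +
      1 / (2 * z * (z ^ 2 + 1))) = Real.pi / 12 * (z ^ 2 * (1 - E2ImAxis z)) - Real.pi / 12 +
      z / (2 * (z ^ 2 + 1)) := by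
    field_simp
  have : z ^ 2 * (Real.pi / 12 * (1 - E2ImAxis z) - Real.pi / (12 * z ^ 2) +
      1 / (2 * z * (z ^ 2 + 1))) < 0 := by rw [key]; linarith
  exact neg_of_mul_neg_right this (sq_nonneg z)

lemma deriv_f_inv {z : ℝ} (hz : 0 < z) : deriv f z⁻¹ = -z ^ 2 * deriv f z := by
  rw [(hasDerivAt_f hz).deriv, (hasDerivAt_f (inv_pos.mpr hz)).deriv, E2ImAxis_inv hz]
  field_simp
  ring

lemma deriv_f_pos {z : ℝ} (hz : 0 < z) (hz1 : z < 1) : 0 < deriv f z := by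
  have h := deriv_f_inv (inv_pos.mpr hz)
  rw [inv_inv] at h
  rw [h]
  have := deriv_f_neg ((one_lt_inv₀ hz).mpr hz1)
  have : 0 < z⁻¹ ^ 2 := by positivity
  nlinarith

/-- Proposition 2.3(d): `f` is differentiable on `(0,∞)`, with
`f'(z) > 0` for `0 < z < 1`, `f'(1) = 0`, `f'(z) < 0` for `z > 1`; in particular
`f` is strictly increasing on `(0,1]` and strictly decreasing on `[1,∞)`. -/
theorem stmt7 :
    (∀ z ∈ Set.Ioi (0 : ℝ), DifferentiableAt ℝ f z) ∧
    (∀ z : ℝ, 0 < z → z < 1 → 0 < deriv f z) ∧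
    deriv f 1 = 0 ∧
    (∀ z : ℝ, 1 < z → deriv f z < 0) ∧
    StrictMonoOn f (Set.Ioc 0 1) ∧
    StrictAntiOn f (Set.Ici 1) := by
  refine ⟨fun z hz ↦ (hasDerivAt_f hz).differentiableAt, fun z ↦ deriv_f_pos, ?_,
    fun z ↦ deriv_f_neg, ?_, ?_⟩
  · have := deriv_f_inv one_pos
    rw [inv_one] at this
    linarith
  · refine strictMonoOn_of_deriv_pos (convex_Ioc 0 1)
      (fun z hz ↦ (hasDerivAt_f hz.1).continuousAt.continuousWithinAt) fun z hz ↦ ?_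
    rw [interior_Ioc] at hz
    exact deriv_f_pos hz.1 hz.2
  · refine strictAntiOn_of_deriv_neg (convex_Ici 1)
      (fun z hz ↦ (hasDerivAt_f (zero_lt_one.trans_le hz)).continuousAt.continuousWithinAt)
      fun z hz ↦ ?_
    rw [interior_Ici] at hz
    exact deriv_f_neg hz
end

section
/- For every real z > 0: (a) g(z) = -g(1/z); (b) lim_{z→0⁺} g(z) = 0 and lim_{z→+∞} g(z) = 0; (c) g is strictly decreasing on the interval [1/√2, √2]; (d) g(z) > 0 for 1/√2 ≤ z < 1, g(1) = 0, and g(z) < 0 for 1 < z ≤ √2; (e) |g(z)| ≤ log ∏_{n=1}^∞ (1 - e^{-2πn}) + π/12 - (1/4)·log 2 for all z > 0. -/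
/-- `g(z) = log ∏_{n=1}^∞ (1 + e^{-√2 π n z}) - π/(12 √2 z) + (1/4) log((z²+2)/(z²+1/2))`. -/
noncomputable def g (z : ℝ) : ℝ :=
  Real.log (∏' n : ℕ, (1 + Real.exp (-Real.sqrt 2 * Real.pi * ((n : ℝ) + 1) * z))) -
    Real.pi / (12 * Real.sqrt 2 * z) + (1 / 4) * Real.log ((z ^ 2 + 2) / (z ^ 2 + 1 / 2))

open Filter Topology ModularForm

lemma summable_pow_succ {r : ℝ} (h0 : 0 ≤ r) (h1 : r < 1) :
    Summable fun n : ℕ ↦ r ^ (n + 1) :=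
  (summable_nat_add_iff 1).mpr (summable_geometric_of_lt_one h0 h1)

lemma tsum_pow_succ {r : ℝ} (h0 : 0 ≤ r) (h1 : r < 1) :
    ∑' n : ℕ, r ^ (n + 1) = r / (1 - r) := by
  simp_rw [pow_succ, tsum_mul_right, tsum_geometric_of_lt_one h0 h1]
  ring

lemma multipliable_one_add_pow_succ {r : ℝ} (h0 : 0 ≤ r) (h1 : r < 1) :
    Multipliable fun n : ℕ ↦ 1 + r ^ (n + 1) :=
  Real.multipliable_one_add_of_summable (summable_pow_succ h0 h1)

lemma multipliable_one_sub_pow_succ {r : ℝ} (h0 : 0 ≤ r) (h1 : r < 1) :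
    Multipliable fun n : ℕ ↦ 1 - r ^ (n + 1) := by
  simpa [sub_eq_add_neg] using
    Real.multipliable_one_add_of_summable (summable_pow_succ h0 h1).neg

lemma summable_log_one_add_pow_succ {r : ℝ} (h0 : 0 ≤ r) (h1 : r < 1) :
    Summable fun n : ℕ ↦ Real.log (1 + r ^ (n + 1)) :=
  Real.summable_log_one_add_of_summable (summable_pow_succ h0 h1)

lemma summable_log_one_sub_pow_succ {r : ℝ} (h0 : 0 ≤ r) (h1 : r < 1) :
    Summable fun n : ℕ ↦ Real.log (1 - r ^ (n + 1)) := by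
  simpa [sub_eq_add_neg] using
    Real.summable_log_one_add_of_summable (summable_pow_succ h0 h1).neg

lemma exp_tsum_log_one_add_pow_succ {r : ℝ} (h0 : 0 ≤ r) (h1 : r < 1) :
    Real.exp (∑' n : ℕ, Real.log (1 + r ^ (n + 1))) = ∏' n : ℕ, (1 + r ^ (n + 1)) :=
  Real.rexp_tsum_eq_tprod (fun _ ↦ by positivity) (summable_log_one_add_pow_succ h0 h1)

lemma exp_tsum_log_one_sub_pow_succ {r : ℝ} (h0 : 0 ≤ r) (h1 : r < 1) :
    Real.exp (∑' n : ℕ, Real.log (1 - r ^ (n + 1))) = ∏' n : ℕ, (1 - r ^ (n + 1)) :=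
  Real.rexp_tsum_eq_tprod (fun n ↦ sub_pos.mpr (pow_lt_one₀ h0 h1 n.succ_ne_zero))
    (summable_log_one_sub_pow_succ h0 h1)

lemma tprod_one_add_pow_succ_pos {r : ℝ} (h0 : 0 ≤ r) (h1 : r < 1) :
    0 < ∏' n : ℕ, (1 + r ^ (n + 1)) := by
  rw [← exp_tsum_log_one_add_pow_succ h0 h1]
  exact Real.exp_pos _

lemma tprod_one_sub_pow_succ_pos {r : ℝ} (h0 : 0 ≤ r) (h1 : r < 1) :
    0 < ∏' n : ℕ, (1 - r ^ (n + 1)) := by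
  rw [← exp_tsum_log_one_sub_pow_succ h0 h1]
  exact Real.exp_pos _

lemma log_tprod_one_add_pow_succ {r : ℝ} (h0 : 0 ≤ r) (h1 : r < 1) :
    Real.log (∏' n : ℕ, (1 + r ^ (n + 1))) = ∑' n : ℕ, Real.log (1 + r ^ (n + 1)) := by
  rw [← exp_tsum_log_one_add_pow_succ h0 h1, Real.log_exp]

lemma log_tprod_one_sub_pow_succ {r : ℝ} (h0 : 0 ≤ r) (h1 : r < 1) :
    Real.log (∏' n : ℕ, (1 - r ^ (n + 1))) = ∑' n : ℕ, Real.log (1 - r ^ (n + 1)) := by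
  rw [← exp_tsum_log_one_sub_pow_succ h0 h1, Real.log_exp]

lemma tprod_one_add_pow_succ_mul_tprod_one_sub {r : ℝ} (h0 : 0 ≤ r) (h1 : r < 1) :
    (∏' n : ℕ, (1 + r ^ (n + 1))) * ∏' n : ℕ, (1 - r ^ (n + 1)) =
      ∏' n : ℕ, (1 - (r ^ 2) ^ (n + 1)) := by
  rw [← (multipliable_one_add_pow_succ h0 h1).tprod_mul (multipliable_one_sub_pow_succ h0 h1)]
  refine tprod_congr fun n ↦ ?_
  rw [← pow_mul, mul_comm 2, pow_mul]
  ring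

lemma log_tprod_one_add_pow_succ_nonneg {r : ℝ} (h0 : 0 ≤ r) (h1 : r < 1) :
    0 ≤ Real.log (∏' n : ℕ, (1 + r ^ (n + 1))) := by
  rw [log_tprod_one_add_pow_succ h0 h1]
  exact tsum_nonneg fun n ↦ Real.log_nonneg (by linarith [pow_nonneg h0 (n + 1)])

lemma log_tprod_one_add_pow_succ_le {r : ℝ} (h0 : 0 ≤ r) (h1 : r < 1) :
    Real.log (∏' n : ℕ, (1 + r ^ (n + 1))) ≤ r / (1 - r) := by
  rw [log_tprod_one_add_pow_succ h0 h1, ← tsum_pow_succ h0 h1]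
  refine (summable_log_one_add_pow_succ h0 h1).tsum_le_tsum (fun n ↦ ?_) (summable_pow_succ h0 h1)
  have := Real.log_le_sub_one_of_pos (show 0 < 1 + r ^ (n + 1) by positivity)
  linarith

lemma neg_div_sq_le_log_tprod_one_sub_pow_succ {r : ℝ} (h0 : 0 ≤ r) (h1 : r < 1) :
    -(r / (1 - r) ^ 2) ≤ Real.log (∏' n : ℕ, (1 - r ^ (n + 1))) := by
  have hr : 0 < 1 - r := sub_pos.mpr h1
  have key : -(r / (1 - r) ^ 2) = ∑' n : ℕ, -(1 - r)⁻¹ * r ^ (n + 1) := by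
    rw [tsum_mul_left, tsum_pow_succ h0 h1]
    field_simp
  rw [log_tprod_one_sub_pow_succ h0 h1, key]
  refine ((summable_pow_succ h0 h1).mul_left _).tsum_le_tsum (fun n ↦ ?_)
    (summable_log_one_sub_pow_succ h0 h1)
  have hp : r ^ (n + 1) ≤ r := pow_le_of_le_one h0 h1.le n.succ_ne_zero
  have hpos : 0 < 1 - r ^ (n + 1) := by linarith
  refine le_trans ?_ (Real.one_sub_inv_le_log_of_pos hpos)
  have hinv : (1 - r ^ (n + 1))⁻¹ ≤ (1 - r)⁻¹ := inv_anti₀ hr (by linarith)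
  have h2 : 1 - (1 - r ^ (n + 1))⁻¹ = -(1 - r ^ (n + 1))⁻¹ * r ^ (n + 1) := by
    field_simp
    ring
  rw [h2]
  nlinarith [pow_nonneg h0 (n + 1)]

lemma log_tprod_one_add_pow_succ_sub_le {r s : ℝ} (h0 : 0 ≤ r) (hrs : r ≤ s) (h1 : s < 1) :
    Real.log (∏' n : ℕ, (1 + r ^ (n + 1))) - Real.log (1 + r) ≤
      Real.log (∏' n : ℕ, (1 + s ^ (n + 1))) - Real.log (1 + s) := by
  have hs0 := h0.trans hrs
  have hr1 := hrs.trans_lt h1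
  have hr := summable_log_one_add_pow_succ h0 hr1
  have hs := summable_log_one_add_pow_succ hs0 h1
  rw [log_tprod_one_add_pow_succ h0 hr1, log_tprod_one_add_pow_succ hs0 h1,
    hr.tsum_eq_zero_add, hs.tsum_eq_zero_add]
  simp only [zero_add, pow_one, add_sub_cancel_left]
  refine ((summable_nat_add_iff 1).mpr hr).tsum_le_tsum (fun n ↦ ?_)
    ((summable_nat_add_iff 1).mpr hs)
  gcongr

/-- The value of the Dedekind eta function at `I * y`, as a real number. -/
noncomputable def etaReal (y : ℝ) : ℝ :=
  Real.exp (-(Real.pi * y / 12)) * ∏' n : ℕ, (1 - Real.exp (-(2 * Real.pi * y)) ^ (n + 1))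

lemma etaReal_pos {y : ℝ} (hy : 0 < y) : 0 < etaReal y :=
  mul_pos (Real.exp_pos _) (tprod_one_sub_pow_succ_pos (Real.exp_pos _).le
    (Real.exp_lt_one_iff.mpr (neg_lt_zero.mpr (by positivity))))

lemma eta_I_mul_s9 {y : ℝ} (hy : 0 < y) : eta (Complex.I * y) = etaReal y := by
  have h1 : Real.exp (-(2 * Real.pi * y)) < 1 :=
    Real.exp_lt_one_iff.mpr (neg_lt_zero.mpr (by positivity))
  have := (multipliable_one_sub_pow_succ (Real.exp_pos _).le h1).map_tprod Complex.ofRealHom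
    Complex.continuous_ofReal
  simp only [Complex.ofRealHom_eq_coe] at this
  rw [eta, etaReal, Complex.ofReal_mul, this]
  congr 1
  · rw [Function.Periodic.qParam, Complex.ofReal_exp]
    congr 1
    push_cast
    linear_combination (2 * Real.pi * y / 24 : ℂ) * Complex.I_sq
  · refine tprod_congr fun n ↦ ?_
    rw [eta_q_eq_pow]
    push_cast
    congr 3
    linear_combination (2 * Real.pi * y : ℂ) * Complex.I_sq

lemma etaReal_inv_sq {y : ℝ} (hy : 0 < y) : etaReal y⁻¹ ^ 2 = y * etaReal y ^ 2 := by
  have hmem : Complex.I * y ∈ UpperHalfPlane.upperHalfPlaneSet := by simpa using hy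
  have h := eta_comp_eq_csqrt_I_inv hmem
  have hdiv : -1 / (Complex.I * y) = Complex.I * ((y⁻¹ : ℝ) : ℂ) := by
    have : (y : ℂ) ≠ 0 := by exact_mod_cast hy.ne'
    push_cast
    field_simp
    simp
  have hsq (w : ℂ) : w.sqrt ^ 2 = w := by
    simp [Complex.sqrt]
  simp only [Function.comp_apply, hdiv, Pi.smul_apply, Pi.mul_apply, smul_eq_mul,
    eta_I_mul_s9 hy, eta_I_mul_s9 (inv_pos.mpr hy)] at h
  have h2 := congrArg (· ^ 2) h
  simp only [mul_pow, inv_pow, hsq] at h2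
  have h3 : ((etaReal y⁻¹ ^ 2 : ℝ) : ℂ) = ((y * etaReal y ^ 2 : ℝ) : ℂ) := by
    push_cast
    rw [h2]
    field_simp
  exact_mod_cast h3

lemma log_etaReal_inv {y : ℝ} (hy : 0 < y) :
    2 * Real.log (etaReal y⁻¹) = Real.log y + 2 * Real.log (etaReal y) := by
  have h := congrArg Real.log (etaReal_inv_sq hy)
  have hne := (etaReal_pos hy).ne'
  rw [Real.log_mul hy.ne' (pow_ne_zero _ hne), Real.log_pow, Real.log_pow] at h
  exact_mod_cast h

lemma log_etaReal {y : ℝ} (hy : 0 < y) : Real.log (etaReal y) = -(Real.pi * y / 12) +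
    Real.log (∏' n : ℕ, (1 - Real.exp (-(2 * Real.pi * y)) ^ (n + 1))) := by
  have h1 : Real.exp (-(2 * Real.pi * y)) < 1 :=
    Real.exp_lt_one_iff.mpr (neg_lt_zero.mpr (by positivity))
  rw [etaReal, Real.log_mul (Real.exp_pos _).ne'
    (tprod_one_sub_pow_succ_pos (Real.exp_pos _).le h1).ne', Real.log_exp]

lemma log_tprod_one_add_exp_pow_succ {y : ℝ} (hy : 0 < y) :
    Real.log (∏' n : ℕ, (1 + Real.exp (-(2 * Real.pi * y)) ^ (n + 1))) =
      Real.log (etaReal (2 * y)) - Real.log (etaReal y) + Real.pi * y / 12 := by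
  have h0 := (Real.exp_pos (-(2 * Real.pi * y))).le
  have h1 : Real.exp (-(2 * Real.pi * y)) < 1 :=
    Real.exp_lt_one_iff.mpr (neg_lt_zero.mpr (by positivity))
  have h := congrArg Real.log (tprod_one_add_pow_succ_mul_tprod_one_sub h0 h1)
  rw [Real.log_mul (tprod_one_add_pow_succ_pos h0 h1).ne'
    (tprod_one_sub_pow_succ_pos h0 h1).ne', ← Real.exp_nat_mul] at h
  rw [log_etaReal hy, log_etaReal (by positivity), eq_sub_of_add_eq h,
    show ((2 : ℕ) : ℝ) * -(2 * Real.pi * y) = -(2 * Real.pi * (2 * y)) by push_cast; ring]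
  ring

/-- The base `e^{-√2 π z}` of the product defining `g`. -/
noncomputable def gBase (z : ℝ) : ℝ := Real.exp (-(Real.sqrt 2 * Real.pi * z))

lemma gBase_nonneg (z : ℝ) : 0 ≤ gBase z := (Real.exp_pos _).le

lemma gBase_lt_one {z : ℝ} (hz : 0 < z) : gBase z < 1 :=
  Real.exp_lt_one_iff.mpr (neg_lt_zero.mpr (by positivity))

lemma g_eq (z : ℝ) : g z = Real.log (∏' n : ℕ, (1 + gBase z ^ (n + 1))) -
    Real.pi / (12 * Real.sqrt 2 * z) + (1 / 4) * Real.log ((z ^ 2 + 2) / (z ^ 2 + 1 / 2)) := by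
  have h (n : ℕ) : Real.exp (-Real.sqrt 2 * Real.pi * ((n : ℝ) + 1) * z) = gBase z ^ (n + 1) := by
    rw [gBase, ← Real.exp_nat_mul]
    push_cast
    ring_nf
  simp only [g, h]

lemma g_one_div {z : ℝ} (hz : 0 < z) : g z = -g (1 / z) := by
  have hsq : Real.sqrt 2 * Real.sqrt 2 = 2 := Real.mul_self_sqrt (by norm_num)
  have hbase {w : ℝ} : gBase w = Real.exp (-(2 * Real.pi * (w / Real.sqrt 2))) := by
    rw [gBase]
    congr 2
    field_simp
    linear_combination w * hsq
  have hinv {w : ℝ} (hw : 0 < w) : 2 * (w⁻¹ / Real.sqrt 2) = (w / Real.sqrt 2)⁻¹ := by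
    field_simp
    linear_combination -hsq
  have hinv' : z⁻¹ / Real.sqrt 2 = (2 * (z / Real.sqrt 2))⁻¹ := by
    field_simp
    linear_combination -hsq
  have hy : 0 < z / Real.sqrt 2 := by positivity
  have e1 := log_etaReal_inv hy
  have e2 := log_etaReal_inv (show 0 < 2 * (z / Real.sqrt 2) by positivity)
  rw [Real.log_mul (by norm_num) hy.ne'] at e2
  have hrat : Real.log ((z ^ 2 + 2) / (z ^ 2 + 1 / 2)) +
      Real.log ((z⁻¹ ^ 2 + 2) / (z⁻¹ ^ 2 + 1 / 2)) = 2 * Real.log 2 := by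
    rw [← Real.log_mul (by positivity) (by positivity), ← Nat.cast_ofNat (R := ℝ) (n := 2),
      ← Real.log_pow]
    congr 1
    push_cast
    field_simp
    ring
  have hpi : Real.pi / (12 * Real.sqrt 2 * z) = Real.pi * (z⁻¹ / Real.sqrt 2) / 12 := by
    field_simp
  have hpi' : Real.pi / (12 * Real.sqrt 2 * z⁻¹) = Real.pi * (z / Real.sqrt 2) / 12 := by
    field_simp
  rw [one_div, g_eq, g_eq, hbase, hbase, log_tprod_one_add_exp_pow_succ hy,
    log_tprod_one_add_exp_pow_succ (show 0 < z⁻¹ / Real.sqrt 2 by positivity), hinv hz,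
    hpi, hpi', hinv']
  linarith

lemma tendsto_g_atTop : Tendsto g atTop (𝓝 0) := by
  have hbase : Tendsto gBase atTop (𝓝 0) :=
    Real.tendsto_exp_neg_atTop_nhds_zero.comp
      (tendsto_id.const_mul_atTop (show 0 < Real.sqrt 2 * Real.pi by positivity))
  have hprod : Tendsto (fun z ↦ Real.log (∏' n : ℕ, (1 + gBase z ^ (n + 1)))) atTop (𝓝 0) := by
    have hbound : Tendsto (fun z ↦ gBase z / (1 - gBase z)) atTop (𝓝 0) := by
      simpa [Pi.div_def] using hbase.div (hbase.const_sub 1) (by norm_num)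
    refine squeeze_zero' ?_ ?_ hbound
    · filter_upwards [eventually_gt_atTop 0] with z hz
      exact log_tprod_one_add_pow_succ_nonneg (gBase_nonneg z) (gBase_lt_one hz)
    · filter_upwards [eventually_gt_atTop 0] with z hz
      exact log_tprod_one_add_pow_succ_le (gBase_nonneg z) (gBase_lt_one hz)
  have hpole : Tendsto (fun z : ℝ ↦ Real.pi / (12 * Real.sqrt 2 * z)) atTop (𝓝 0) :=
    (tendsto_id.const_mul_atTop (show 0 < 12 * Real.sqrt 2 by positivity)).const_div_atTop _
  have hrat : Tendsto (fun z : ℝ ↦ (z ^ 2 + 2) / (z ^ 2 + 1 / 2)) atTop (𝓝 1) := by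
    have h : Tendsto (fun z : ℝ ↦ 1 + 3 / 2 / (z ^ 2 + 1 / 2)) atTop (𝓝 (1 + 0)) :=
      ((tendsto_atTop_add_const_right _ _ (tendsto_pow_atTop two_ne_zero)).const_div_atTop
        _).const_add 1
    rw [add_zero] at h
    refine h.congr fun z ↦ ?_
    field_simp
    ring
  have hlog := (hrat.log one_ne_zero).const_mul (1 / 4)
  rw [funext g_eq]
  simpa using (hprod.sub hpole).add hlog

lemma tendsto_g_nhdsGT_zero : Tendsto g (𝓝[>] 0) (𝓝 0) := by
  have h := (tendsto_g_atTop.comp (tendsto_inv_nhdsGT_zero (𝕜 := ℝ))).neg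
  rw [neg_zero] at h
  refine h.congr' ?_
  filter_upwards [self_mem_nhdsWithin] with z hz
  simp [g_one_div (z := z) hz]

lemma sqrt_two_mul_pi_bounds : 4.44 < Real.sqrt 2 * Real.pi ∧ Real.sqrt 2 * Real.pi < 4.443 := by
  have h1 : 1.4142 < Real.sqrt 2 := Real.lt_sqrt_of_sq_lt (by norm_num)
  have h2 : Real.sqrt 2 < 1.41422 := (Real.sqrt_lt' (by norm_num)).mpr (by norm_num)
  constructor <;> nlinarith [Real.pi_gt_d6, Real.pi_lt_d6]

lemma pi_div_twelve_mul_sqrt_two (z : ℝ) :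
    Real.pi / (12 * Real.sqrt 2 * z) = Real.sqrt 2 * Real.pi / 24 / z := by
  have hsq : Real.sqrt 2 * Real.sqrt 2 = 2 := Real.mul_self_sqrt (by norm_num)
  rcases eq_or_ne z 0 with rfl | hz
  · simp
  · field_simp
    linear_combination -12 * hsq

lemma log_div_eq_sub_log (z : ℝ) : Real.log ((z ^ 2 + 2) / (z ^ 2 + 1 / 2)) =
    Real.log (z ^ 2 + 2) - Real.log (z ^ 2 + 1 / 2) :=
  Real.log_div (by positivity) (by positivity)

/-- `g` with all factors of the product but the first one removed. -/
noncomputable def gHead (z : ℝ) : ℝ := Real.log (1 + gBase z) -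
  Real.sqrt 2 * Real.pi / 24 / z + (1 / 4) * (Real.log (z ^ 2 + 2) - Real.log (z ^ 2 + 1 / 2))

lemma hasDerivAt_gHead {z : ℝ} (hz : 0 < z) : HasDerivAt gHead
    (-(Real.sqrt 2 * Real.pi) / (Real.exp (Real.sqrt 2 * Real.pi * z) + 1) +
      Real.sqrt 2 * Real.pi / 24 / z ^ 2 -
      3 / 4 * z / ((z ^ 2 + 2) * (z ^ 2 + 1 / 2))) z := by
  have hb : HasDerivAt gBase (gBase z * -(Real.sqrt 2 * Real.pi * 1)) z :=
    (((hasDerivAt_id z).const_mul (Real.sqrt 2 * Real.pi)).neg).exp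
  have hpos : 0 < gBase z := Real.exp_pos _
  have h1 := (hb.const_add 1).log (by positivity)
  have h2 := (hasDerivAt_inv hz.ne').const_mul (Real.sqrt 2 * Real.pi / 24)
  have h3 := (((hasDerivAt_pow 2 z).add_const 2).log (by positivity)).sub
    (((hasDerivAt_pow 2 z).add_const (1 / 2)).log (by positivity))
  refine ((h1.sub h2).add (h3.const_mul (1 / 4))).congr_deriv ?_
  have he : Real.exp (Real.sqrt 2 * Real.pi * z) = (gBase z)⁻¹ := by
    rw [gBase, Real.exp_neg, inv_inv]
  rw [he]
  field_simp
  ring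

lemma exp_sqrt_two_mul_pi_mul_le {z : ℝ} (h0 : 0 ≤ z) (hz : z ≤ 1.15) :
    Real.exp (Real.sqrt 2 * Real.pi * z) ≤ 169 := by
  have hle : Real.sqrt 2 * Real.pi * z ≤ 5 + 0.12 := by
    nlinarith [sqrt_two_mul_pi_bounds.1, sqrt_two_mul_pi_bounds.2]
  have h5 : Real.exp 5 ≤ 148.5 := by
    have h := pow_le_pow_left₀ (Real.exp_pos 1).le Real.exp_one_lt_d9.le 5
    rw [← Real.exp_nat_mul] at h
    norm_num at h ⊢
    linarith
  have hs : Real.exp 0.12 ≤ 1.137 :=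
    (Real.exp_bound_div_one_sub_of_interval (by norm_num) (by norm_num)).trans (by norm_num)
  calc Real.exp (Real.sqrt 2 * Real.pi * z) ≤ Real.exp (5 + 0.12) := Real.exp_le_exp.mpr hle
    _ = Real.exp 5 * Real.exp 0.12 := Real.exp_add _ _
    _ ≤ 148.5 * 1.137 := by gcongr
    _ ≤ 169 := by norm_num

lemma gHead_deriv_neg {z : ℝ} (h1 : 1 ≤ z) (h2 : z ≤ 1.415) :
    -(Real.sqrt 2 * Real.pi) / (Real.exp (Real.sqrt 2 * Real.pi * z) + 1) +
      Real.sqrt 2 * Real.pi / 24 / z ^ 2 -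
      3 / 4 * z / ((z ^ 2 + 2) * (z ^ 2 + 1 / 2)) < 0 := by
  obtain ⟨ha, ha'⟩ := sqrt_two_mul_pi_bounds
  have hE := Real.exp_pos (Real.sqrt 2 * Real.pi * z)
  have hk : Real.sqrt 2 * Real.pi / 24 / z ^ 2 ≤ 0.1852 / z ^ 2 := by
    gcongr
    linarith
  rcases le_total z 1.15 with hz | hz
  · have hexp : 0.026 ≤ Real.sqrt 2 * Real.pi / (Real.exp (Real.sqrt 2 * Real.pi * z) + 1) := by
      rw [le_div_iff₀ (by positivity)]
      linarith [exp_sqrt_two_mul_pi_mul_le (by linarith) hz]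
    have key : 0.1852 / z ^ 2 < 0.026 + 3 / 4 * z / ((z ^ 2 + 2) * (z ^ 2 + 1 / 2)) := by
      rw [← sub_lt_iff_lt_add', div_sub' (by positivity),
        div_lt_div_iff₀ (by positivity) (by positivity)]
      obtain ⟨t, rfl⟩ : ∃ t, z = 1 + t := ⟨z - 1, by ring⟩
      have ht : 0 ≤ t := by linarith
      have ht' : t ≤ 0.15 := by linarith
      nlinarith [pow_nonneg ht 2, pow_nonneg ht 3, pow_nonneg ht 4, pow_nonneg ht 5,
        pow_nonneg ht 6, mul_nonneg ht (sub_nonneg.mpr ht')]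
    rw [neg_div]
    linarith
  · have hexp : 0 < Real.sqrt 2 * Real.pi / (Real.exp (Real.sqrt 2 * Real.pi * z) + 1) := by
      positivity
    have key : 0.1852 / z ^ 2 < 3 / 4 * z / ((z ^ 2 + 2) * (z ^ 2 + 1 / 2)) := by
      rw [div_lt_div_iff₀ (by positivity) (by positivity)]
      obtain ⟨t, rfl⟩ : ∃ t, z = 1.15 + t := ⟨z - 1.15, by ring⟩
      have ht : 0 ≤ t := by linarith
      have ht' : t ≤ 0.265 := by linarith
      nlinarith [pow_nonneg ht 2, pow_nonneg ht 3, pow_nonneg ht 4,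
        mul_nonneg ht (sub_nonneg.mpr ht'),
        mul_nonneg (pow_nonneg ht 2) (sub_nonneg.mpr ht'),
        mul_nonneg (pow_nonneg ht 3) (sub_nonneg.mpr ht')]
    rw [neg_div]
    linarith

lemma strictAntiOn_gHead : StrictAntiOn gHead (Set.Icc 1 (Real.sqrt 2)) := by
  have hs : Real.sqrt 2 < 1.415 := (Real.sqrt_lt' (by norm_num)).mpr (by norm_num)
  refine strictAntiOn_of_deriv_neg (convex_Icc _ _) (fun z hz ↦
    (hasDerivAt_gHead (by linarith [hz.1])).continuousAt.continuousWithinAt) fun z hz ↦ ?_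
  rw [interior_Icc] at hz
  rw [(hasDerivAt_gHead (by linarith [hz.1])).deriv]
  exact gHead_deriv_neg hz.1.le (by linarith [hz.2])

lemma strictAntiOn_g_Icc_one_sqrt_two : StrictAntiOn g (Set.Icc 1 (Real.sqrt 2)) := by
  intro x hx y hy hxy
  have hx0 : 0 < x := by linarith [hx.1]
  have hb : gBase y ≤ gBase x := by
    unfold gBase
    gcongr
  have h := strictAntiOn_gHead hx hy hxy
  have hr := log_tprod_one_add_pow_succ_sub_le (gBase_nonneg y) hb (gBase_lt_one hx0)
  simp only [gHead] at h
  rw [g_eq, g_eq, pi_div_twelve_mul_sqrt_two, pi_div_twelve_mul_sqrt_two, log_div_eq_sub_log,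
    log_div_eq_sub_log]
  linarith

lemma one_le_sqrt_two : 1 ≤ Real.sqrt 2 := Real.one_le_sqrt.mpr one_le_two

lemma strictAntiOn_g : StrictAntiOn g (Set.Icc (1 / Real.sqrt 2) (Real.sqrt 2)) := by
  have hs := one_le_sqrt_two
  have hs0 : 0 < 1 / Real.sqrt 2 := by positivity
  have hs1 : 1 / Real.sqrt 2 ≤ 1 := (div_le_one (by positivity)).mpr hs
  rw [← Set.Icc_union_Icc_eq_Icc hs1 hs]
  refine StrictAntiOn.union ?_ strictAntiOn_g_Icc_one_sqrt_two (isGreatest_Icc hs1)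
    (isLeast_Icc hs)
  have hmem {x : ℝ} (hx : x ∈ Set.Icc (1 / Real.sqrt 2) 1) :
      1 / x ∈ Set.Icc 1 (Real.sqrt 2) := by
    have hx0 := hs0.trans_le hx.1
    exact ⟨(one_le_div hx0).mpr hx.2, (one_div_le (by positivity) hx0).mp hx.1⟩
  intro x hx y hy hxy
  have hx0 := hs0.trans_le hx.1
  rw [g_one_div hx0, g_one_div (hx0.trans hxy)]
  exact neg_lt_neg (strictAntiOn_g_Icc_one_sqrt_two (hmem hy) (hmem hx)
    (one_div_lt_one_div_of_lt hx0 hxy))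

lemma g_one : g 1 = 0 := by
  have h := g_one_div one_pos
  rw [div_one] at h
  linarith

lemma gBase_le {z : ℝ} (hz : 1 ≤ z) : gBase z ≤ 0.0124 := by
  have h4 : (2.718 : ℝ) ^ 4 ≤ Real.exp 4 := by
    have h := pow_le_pow_left₀ (by norm_num) (show (2.718 : ℝ) ≤ Real.exp 1 by
      linarith [Real.exp_one_gt_d9]) 4
    rw [← Real.exp_nat_mul] at h
    norm_num at h ⊢
    linarith
  have hs : (1.48 : ℝ) ≤ Real.exp 0.44 := by
    have h := Real.sum_le_exp_of_nonneg (show (0 : ℝ) ≤ 0.44 by norm_num) 3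
    norm_num [Finset.sum_range_succ, Nat.factorial] at h ⊢
    linarith
  have hle : 4 + 0.44 ≤ Real.sqrt 2 * Real.pi * z := by
    nlinarith [sqrt_two_mul_pi_bounds.1]
  have hE : (80.7 : ℝ) ≤ Real.exp (Real.sqrt 2 * Real.pi * z) :=
    calc (80.7 : ℝ) ≤ 2.718 ^ 4 * 1.48 := by norm_num
      _ ≤ Real.exp 4 * Real.exp 0.44 := by gcongr
      _ = Real.exp (4 + 0.44) := (Real.exp_add _ _).symm
      _ ≤ _ := Real.exp_le_exp.mpr hle
  rw [gBase, Real.exp_neg]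
  exact (inv_anti₀ (by norm_num) hE).trans (by norm_num)

lemma abs_g_le_of_one_le {z : ℝ} (hz : 1 ≤ z) : |g z| ≤ 0.08 := by
  have hz0 : 0 < z := by linarith
  obtain ⟨ha, ha'⟩ := sqrt_two_mul_pi_bounds
  have hb := gBase_le hz
  have hP0 := log_tprod_one_add_pow_succ_nonneg (gBase_nonneg z) (gBase_lt_one hz0)
  have hP1 : Real.log (∏' n : ℕ, (1 + gBase z ^ (n + 1))) ≤ 0.0126 := by
    refine (log_tprod_one_add_pow_succ_le (gBase_nonneg z) (gBase_lt_one hz0)).trans ?_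
    rw [div_le_iff₀ (by linarith)]
    linarith
  have hk : Real.sqrt 2 * Real.pi / 24 / z ≤ 0.1852 / z := by
    gcongr
    linarith
  have hk' : 0.185 / z ≤ Real.sqrt 2 * Real.pi / 24 / z := by
    gcongr
    linarith
  have hrat : (z ^ 2 + 2) / (z ^ 2 + 1 / 2) = 1 + 3 / 2 / (z ^ 2 + 1 / 2) := by
    field_simp
    ring
  have hA := Real.log_le_sub_one_of_pos (show 0 < 1 + 3 / 2 / (z ^ 2 + 1 / 2) by positivity)
  have hA' := Real.le_log_one_add_of_nonneg (show 0 ≤ 3 / 2 / (z ^ 2 + 1 / 2) by positivity)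
  have hA'' : 2 * (3 / 2 / (z ^ 2 + 1 / 2)) / (3 / 2 / (z ^ 2 + 1 / 2) + 2) =
      3 / (2 * z ^ 2 + 5 / 2) := by
    field_simp
    ring
  rw [hA''] at hA'
  have hupper : 3 / 8 / (z ^ 2 + 1 / 2) ≤ 0.067 + 0.185 / z := by
    rw [← sub_nonneg]
    have : 0.067 + 0.185 / z - 3 / 8 / (z ^ 2 + 1 / 2) =
        ((0.067 * z + 0.185) * (z ^ 2 + 1 / 2) - 3 / 8 * z) / (z * (z ^ 2 + 1 / 2)) := by
      field_simp
    rw [this]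
    refine div_nonneg ?_ (by positivity)
    nlinarith [mul_nonneg (sub_nonneg.mpr hz) (sub_nonneg.mpr hz),
      mul_nonneg hz0.le (mul_nonneg (sub_nonneg.mpr hz) (sub_nonneg.mpr hz))]
  have hlower : 0.1852 / z ≤ 0.08 + 3 / 4 / (2 * z ^ 2 + 5 / 2) := by
    rw [← sub_nonneg]
    have : 0.08 + 3 / 4 / (2 * z ^ 2 + 5 / 2) - 0.1852 / z =
        ((0.08 * z - 0.1852) * (2 * z ^ 2 + 5 / 2) + 3 / 4 * z) / (z * (2 * z ^ 2 + 5 / 2)) := by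
      field_simp
      ring
    rw [this]
    refine div_nonneg ?_ (by positivity)
    nlinarith [mul_nonneg (sub_nonneg.mpr hz) (sub_nonneg.mpr hz),
      mul_nonneg hz0.le (sq_nonneg (z - 1.4)), mul_nonneg hz0.le (sq_nonneg (z - 1.2)),
      mul_nonneg (sub_nonneg.mpr hz) (sq_nonneg (z - 1.2))]
  have e1 : 3 / 8 / (z ^ 2 + 1 / 2) = (1 / 4) * (3 / 2 / (z ^ 2 + 1 / 2)) := by ring
  have e2 : 3 / 4 / (2 * z ^ 2 + 5 / 2) = (1 / 4) * (3 / (2 * z ^ 2 + 5 / 2)) := by ring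
  rw [g_eq, pi_div_twelve_mul_sqrt_two, hrat, abs_le]
  constructor <;> linarith

lemma abs_g_le {z : ℝ} (hz : 0 < z) : |g z| ≤ 0.08 := by
  rcases le_total 1 z with h | h
  · exact abs_g_le_of_one_le h
  · rw [g_one_div hz, abs_neg]
    exact abs_g_le_of_one_le ((one_le_div hz).mpr h)

lemma le_log_tprod_one_sub_exp_add : 0.08 ≤
    Real.log (∏' n : ℕ, (1 - Real.exp (-2 * Real.pi * ((n : ℝ) + 1)))) +
      Real.pi / 12 - (1 / 4) * Real.log 2 := by
  have h (n : ℕ) : Real.exp (-2 * Real.pi * ((n : ℝ) + 1)) =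
      Real.exp (-(2 * Real.pi)) ^ (n + 1) := by
    rw [← Real.exp_nat_mul]
    push_cast
    ring_nf
  simp only [h]
  have h0 := (Real.exp_pos (-(2 * Real.pi))).le
  have hsmall : Real.exp (-(2 * Real.pi)) ≤ 0.0026 := by
    have h6 : (2.718 : ℝ) ^ 6 ≤ Real.exp 6 := by
      have h := pow_le_pow_left₀ (by norm_num) (show (2.718 : ℝ) ≤ Real.exp 1 by
        linarith [Real.exp_one_gt_d9]) 6
      rw [← Real.exp_nat_mul] at h
      norm_num at h ⊢
      linarith
    have hE : (400 : ℝ) ≤ Real.exp (2 * Real.pi) :=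
      calc (400 : ℝ) ≤ 2.718 ^ 6 := by norm_num
        _ ≤ Real.exp 6 := h6
        _ ≤ _ := Real.exp_le_exp.mpr (by linarith [Real.pi_gt_d6])
    rw [Real.exp_neg]
    exact (inv_anti₀ (by norm_num) hE).trans (by norm_num)
  have hP := neg_div_sq_le_log_tprod_one_sub_pow_succ h0 (by linarith)
  have hq : Real.exp (-(2 * Real.pi)) / (1 - Real.exp (-(2 * Real.pi))) ^ 2 ≤ 0.003 := by
    rw [div_le_iff₀ (pow_pos (by linarith) 2)]
    nlinarith
  linarith [Real.pi_gt_d6, Real.log_two_lt_d9]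

/-- Proposition 2.5: (a) `g(z) = -g(1/z)` for `z > 0`;
(b) `g(z) → 0` as `z → 0⁺` and as `z → +∞`;
(c) `g` is strictly decreasing on `[1/√2, √2]`;
(d) `g(z) > 0` for `1/√2 ≤ z < 1`, `g(1) = 0`, and `g(z) < 0` for `1 < z ≤ √2`;
(e) `|g(z)| ≤ log ∏_{n=1}^∞ (1 - e^{-2πn}) + π/12 - (1/4) log 2` for all `z > 0`. -/
theorem stmt9 :
    (∀ z : ℝ, 0 < z → g z = -g (1 / z)) ∧
    Filter.Tendsto g (nhdsWithin 0 (Set.Ioi 0)) (nhds 0) ∧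
    Filter.Tendsto g Filter.atTop (nhds 0) ∧
    StrictAntiOn g (Set.Icc (1 / Real.sqrt 2) (Real.sqrt 2)) ∧
    (∀ z : ℝ, 1 / Real.sqrt 2 ≤ z → z < 1 → 0 < g z) ∧
    g 1 = 0 ∧
    (∀ z : ℝ, 1 < z → z ≤ Real.sqrt 2 → g z < 0) ∧
    (∀ z : ℝ, 0 < z →
      |g z| ≤ Real.log (∏' n : ℕ, (1 - Real.exp (-2 * Real.pi * ((n : ℝ) + 1)))) +
        Real.pi / 12 - (1 / 4) * Real.log 2) := by
  have hs : 1 / Real.sqrt 2 ≤ 1 := (div_le_one (by positivity)).mpr one_le_sqrt_two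
  have h1 : (1 : ℝ) ∈ Set.Icc (1 / Real.sqrt 2) (Real.sqrt 2) := ⟨hs, one_le_sqrt_two⟩
  refine ⟨fun z hz ↦ g_one_div hz, tendsto_g_nhdsGT_zero, tendsto_g_atTop, strictAntiOn_g,
    fun z hz hz1 ↦ ?_, g_one, fun z hz1 hz ↦ ?_,
    fun z hz ↦ (abs_g_le hz).trans le_log_tprod_one_sub_exp_add⟩
  · simpa only [g_one] using strictAntiOn_g ⟨hz, hz1.le.trans one_le_sqrt_two⟩ h1 hz1
  · simpa only [g_one] using strictAntiOn_g h1 ⟨hs.trans hz1.le, hz⟩ hz1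
end

section
/- Let t and γ be real numbers with 0 ≤ t ≤ 1 and γ > 0. Then -log ∏_{n=1}^∞ (1 - t·e^{-nγ}) ≤ γ^{-1}·Li₂(t·e^{-γ/2}) ≤ γ^{-1}·Li₂(t). -/
/-- The dilogarithm `Li₂(u) = ∑_{k=1}^∞ u^k/k²`. -/
noncomputable def Li2 (u : ℝ) : ℝ := ∑' k : ℕ, u ^ (k + 1) / ((k : ℝ) + 1) ^ 2

theorem sum_range_exp_neg_mul_le {x : ℝ} (hx : 0 < x) (N : ℕ) :
    ∑ n ∈ Finset.range N, Real.exp (-((n : ℝ) + 1) * x) ≤ Real.exp (-x / 2) / x := by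
  have h1 : Real.exp (-x) < 1 := Real.exp_lt_one_iff.2 (by linarith)
  have h2 : x ≤ Real.exp (x / 2) - Real.exp (-(x / 2)) := by
    have h := Real.self_le_sinh_iff.2 (by linarith : 0 ≤ x / 2)
    rw [Real.sinh_eq] at h
    linarith
  have h3 : Real.exp (-x / 2) * x ≤ 1 - Real.exp (-x) := by
    calc Real.exp (-x / 2) * x
        ≤ Real.exp (-x / 2) * (Real.exp (x / 2) - Real.exp (-(x / 2))) := by gcongr
      _ = 1 - Real.exp (-x) := by
        rw [mul_sub, ← Real.exp_add, ← Real.exp_add, ← Real.exp_zero]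
        congr 2 <;> ring
  have hsum : ∑ n ∈ Finset.range N, Real.exp (-((n : ℝ) + 1) * x)
      = Real.exp (-x) * ∑ n ∈ Finset.range N, Real.exp (-x) ^ n := by
    rw [Finset.mul_sum]
    refine Finset.sum_congr rfl fun n _ => ?_
    rw [← Real.exp_nat_mul, ← Real.exp_add]
    congr 1
    ring
  have hgeom : ∑ n ∈ Finset.range N, Real.exp (-x) ^ n ≤ (1 - Real.exp (-x))⁻¹ := by
    rw [← tsum_geometric_of_lt_one (Real.exp_pos _).le h1]
    exact (summable_geometric_of_lt_one (Real.exp_pos _).le h1).sum_le_tsum _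
      fun _ _ => by positivity
  have hsq : Real.exp (-x) = Real.exp (-x / 2) * Real.exp (-x / 2) := by
    rw [← Real.exp_add]
    congr 1
    ring
  rw [hsum]
  refine (mul_le_mul_of_nonneg_left hgeom (Real.exp_pos _).le).trans ?_
  rw [← div_eq_mul_inv, div_le_div_iff₀ (by linarith) hx]
  calc Real.exp (-x) * x = Real.exp (-x / 2) * (Real.exp (-x / 2) * x) := by
        rw [hsq]; ring
    _ ≤ _ := by gcongr

theorem summable_Li2 {u : ℝ} (h0 : 0 ≤ u) (h1 : u ≤ 1) :
    Summable fun k : ℕ => u ^ (k + 1) / ((k : ℝ) + 1) ^ 2 := by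
  have h := (summable_nat_add_iff 1).2 (Real.summable_one_div_nat_pow.2 one_lt_two)
  refine Summable.of_nonneg_of_le (fun k => by positivity) (fun k => ?_) h
  push_cast
  gcongr
  exact pow_le_one₀ h0 h1

theorem Li2_le_Li2 {u v : ℝ} (h0 : 0 ≤ u) (huv : u ≤ v) (h1 : v ≤ 1) : Li2 u ≤ Li2 v :=
  (summable_Li2 h0 (huv.trans h1)).tsum_le_tsum (fun k => by gcongr)
    (summable_Li2 (h0.trans huv) h1)

theorem sum_range_neg_log_le {t γ : ℝ} (ht0 : 0 ≤ t) (ht1 : t ≤ 1) (hγ : 0 < γ) (N : ℕ) :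
    ∑ n ∈ Finset.range N, -Real.log (1 - t * Real.exp (-((n : ℝ) + 1) * γ)) ≤
      γ⁻¹ * Li2 (t * Real.exp (-γ / 2)) := by
  have hexp : ∀ n : ℕ, Real.exp (-((n : ℝ) + 1) * γ) < 1 := fun n => by
    have : 0 < ((n : ℝ) + 1) * γ := by positivity
    exact Real.exp_lt_one_iff.2 (by linarith)
  have hlog : HasSum (fun k : ℕ => ∑ n ∈ Finset.range N,
      (t * Real.exp (-((n : ℝ) + 1) * γ)) ^ (k + 1) / ((k : ℝ) + 1))
      (∑ n ∈ Finset.range N, -Real.log (1 - t * Real.exp (-((n : ℝ) + 1) * γ))) := by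
    refine hasSum_sum fun n _ => Real.hasSum_pow_div_log_of_abs_lt_one ?_
    rw [abs_of_nonneg (by positivity)]
    exact (mul_le_of_le_one_left (Real.exp_pos _).le ht1).trans_lt (hexp n)
  have hu1 : t * Real.exp (-γ / 2) ≤ 1 :=
    mul_le_one₀ ht1 (Real.exp_pos _).le (Real.exp_le_one_iff.2 (by linarith))
  refine hasSum_le (fun k => ?_) hlog
    ((summable_Li2 (by positivity) hu1).hasSum.mul_left γ⁻¹)
  have hk : (0 : ℝ) < (k : ℝ) + 1 := by positivity
  calc ∑ n ∈ Finset.range N, (t * Real.exp (-((n : ℝ) + 1) * γ)) ^ (k + 1) / ((k : ℝ) + 1)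
      = t ^ (k + 1) / ((k : ℝ) + 1) *
          ∑ n ∈ Finset.range N, Real.exp (-((n : ℝ) + 1) * (((k : ℝ) + 1) * γ)) := by
        rw [Finset.mul_sum]
        refine Finset.sum_congr rfl fun n _ => ?_
        rw [mul_pow, ← Real.exp_nat_mul, mul_div_right_comm]
        congr 2
        push_cast
        ring
    _ ≤ t ^ (k + 1) / ((k : ℝ) + 1) *
          (Real.exp (-(((k : ℝ) + 1) * γ) / 2) / (((k : ℝ) + 1) * γ)) := by
        gcongr
        exact sum_range_exp_neg_mul_le (by positivity) N
    _ = γ⁻¹ * ((t * Real.exp (-γ / 2)) ^ (k + 1) / ((k : ℝ) + 1) ^ 2) := by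
        have : Real.exp (-(((k : ℝ) + 1) * γ) / 2) = Real.exp (-γ / 2) ^ (k + 1) := by
          rw [← Real.exp_nat_mul]
          congr 1
          push_cast
          ring
        rw [this, mul_pow]
        field_simp

/-- Proposition 2.6, upper bound: For real `0 ≤ t ≤ 1` and `γ > 0`,
`-log ∏_{n=1}^∞ (1 - t e^{-nγ}) ≤ γ⁻¹ Li₂(t e^{-γ/2}) ≤ γ⁻¹ Li₂(t)`. -/
theorem stmt10 (t γ : ℝ) (ht0 : 0 ≤ t) (ht1 : t ≤ 1) (hγ : 0 < γ) :
    -Real.log (∏' n : ℕ, (1 - t * Real.exp (-((n : ℝ) + 1) * γ))) ≤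
      γ⁻¹ * Li2 (t * Real.exp (-γ / 2)) ∧
    γ⁻¹ * Li2 (t * Real.exp (-γ / 2)) ≤ γ⁻¹ * Li2 t := by
  constructor
  · have hpos : ∀ n : ℕ, 0 < 1 - t * Real.exp (-((n : ℝ) + 1) * γ) := fun n => by
      have h : Real.exp (-((n : ℝ) + 1) * γ) < 1 := by
        have : 0 < ((n : ℝ) + 1) * γ := by positivity
        exact Real.exp_lt_one_iff.2 (by linarith)
      linarith [mul_le_of_le_one_left (Real.exp_pos (-((n : ℝ) + 1) * γ)).le ht1]
    have hnonneg : ∀ n : ℕ, 0 ≤ -Real.log (1 - t * Real.exp (-((n : ℝ) + 1) * γ)) := fun n =>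
      neg_nonneg.2 (Real.log_nonpos (hpos n).le (sub_le_self _ (by positivity)))
    have hbound := sum_range_neg_log_le ht0 ht1 hγ
    have hs := summable_of_sum_range_le hnonneg hbound
    rw [← Real.rexp_tsum_eq_tprod hpos (summable_neg_iff.1 hs), Real.log_exp, ← tsum_neg]
    exact Real.tsum_le_of_sum_range_le hnonneg hbound
  · have h : t * Real.exp (-γ / 2) ≤ t :=
      mul_le_of_le_one_right ht0 (Real.exp_le_one_iff.2 (by linarith))
    exact mul_le_mul_of_nonneg_left (Li2_le_Li2 (by positivity) h ht1) (by positivity)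
end

section
/- Let t and γ be real numbers with 0 ≤ t ≤ 1 and γ > 0. Then -log ∏_{n=1}^∞ (1 - t·e^{-nγ}) ≥ γ^{-1}·Li₂(t·e^{-γ}) - (1/2)·log(1 - t·e^{-γ}); moreover, if in addition t < 1, then -log ∏_{n=1}^∞ (1 - t·e^{-nγ}) ≥ γ^{-1}·Li₂(t) + (1/2)·log(1 - t). -/
/-- The `(1,1)` Padé bound for the exponential, written with `exp (-x)`. -/
lemma two_sub_le_two_add_mul_exp_neg {x : ℝ} (hx : 0 ≤ x) :
    2 - x ≤ (2 + x) * Real.exp (-x) := by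
  have hderiv : ∀ y : ℝ, HasDerivAt (fun y : ℝ ↦ (2 + y) * Real.exp (-y) + y)
      (1 - (1 + y) * Real.exp (-y)) y := by
    intro y
    have h1 : HasDerivAt (fun y : ℝ ↦ 2 + y) 1 y := (hasDerivAt_id y).const_add 2
    have h2 : HasDerivAt (fun y : ℝ ↦ Real.exp (-y)) (Real.exp (-y) * -1) y :=
      (hasDerivAt_neg y).exp
    refine ((h1.mul h2).add (hasDerivAt_id y)).congr_deriv ?_
    ring
  have hmono : Monotone (fun y : ℝ ↦ (2 + y) * Real.exp (-y) + y) := by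
    refine monotone_of_deriv_nonneg (fun y ↦ (hderiv y).differentiableAt) fun y ↦ ?_
    rw [(hderiv y).deriv, sub_nonneg, Real.exp_neg, ← div_eq_mul_inv,
      div_le_one (Real.exp_pos y)]
    linarith [Real.add_one_le_exp y]
  have h := hmono hx
  norm_num at h
  linarith

lemma inv_add_half_le_inv_one_sub_exp_neg {x : ℝ} (hx : 0 < x) :
    x⁻¹ + 1 / 2 ≤ (1 - Real.exp (-x))⁻¹ := by
  have hpos : 0 < 1 - Real.exp (-x) := by
    simpa using hx
  rw [← one_div (1 - Real.exp (-x)), le_div_iff₀ hpos, ← one_div,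
    show (1 / x + 1 / 2) * (1 - Real.exp (-x)) = ((2 + x) * (1 - Real.exp (-x))) / (2 * x) by
      field_simp,
    div_le_one (by positivity)]
  linarith [two_sub_le_two_add_mul_exp_neg hx.le]

/-- The Lambert series of `-log ∏ (1 - t qⁿ)`. -/
lemma hasSum_neg_log_tprod_one_sub_mul_pow {t q : ℝ} (ht0 : 0 ≤ t) (ht1 : t ≤ 1)
    (hq0 : 0 < q) (hq1 : q < 1) :
    HasSum (fun k : ℕ ↦ (t * q) ^ (k + 1) / ((k : ℝ) + 1) * (1 - q ^ (k + 1))⁻¹)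
      (-Real.log (∏' n : ℕ, (1 - t * q ^ (n + 1)))) := by
  have hu0 : ∀ n : ℕ, 0 ≤ t * q ^ (n + 1) := fun n ↦ by positivity
  have hu1 : ∀ n : ℕ, t * q ^ (n + 1) < 1 := fun n ↦
    (mul_le_of_le_one_left (by positivity) ht1).trans_lt (pow_lt_one₀ hq0.le hq1 (by simp))
  have hlog : Summable fun n : ℕ ↦ Real.log (1 - t * q ^ (n + 1)) := by
    have hs : Summable fun n : ℕ ↦ -(t * q ^ (n + 1)) :=
      (((summable_nat_add_iff 1).2 (summable_geometric_of_lt_one hq0.le hq1)).mul_left t).neg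
    simpa [sub_eq_add_neg] using Real.summable_log_one_add_of_summable hs
  have hprod : Real.log (∏' n : ℕ, (1 - t * q ^ (n + 1))) =
      ∑' n : ℕ, Real.log (1 - t * q ^ (n + 1)) := by
    rw [← Real.rexp_tsum_eq_tprod (fun n ↦ sub_pos.2 (hu1 n)) hlog, Real.log_exp]
  have hrow : ∀ n : ℕ, HasSum (fun k : ℕ ↦ (t * q ^ (n + 1)) ^ (k + 1) / ((k : ℝ) + 1))
      (-Real.log (1 - t * q ^ (n + 1))) := fun n ↦
    Real.hasSum_pow_div_log_of_abs_lt_one (by rw [abs_of_nonneg (hu0 n)]; exact hu1 n)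
  have hcol : ∀ k : ℕ, HasSum (fun n : ℕ ↦ (t * q ^ (n + 1)) ^ (k + 1) / ((k : ℝ) + 1))
      ((t * q) ^ (k + 1) / ((k : ℝ) + 1) * (1 - q ^ (k + 1))⁻¹) := by
    intro k
    have hgeom := (hasSum_geometric_of_lt_one (by positivity)
      (pow_lt_one₀ hq0.le hq1 k.succ_ne_zero)).mul_left ((t * q) ^ (k + 1) / ((k : ℝ) + 1))
    refine hgeom.congr_fun fun n ↦ ?_
    rw [div_mul_eq_mul_div, ← pow_mul, mul_comm k.succ n, pow_mul, ← mul_pow]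
    congr 2
    ring
  have hsum : Summable fun p : ℕ × ℕ ↦ (t * q ^ (p.1 + 1)) ^ (p.2 + 1) / ((p.2 : ℝ) + 1) := by
    refine (summable_prod_of_nonneg fun p ↦ ?_).2 ⟨fun n ↦ (hrow n).summable, ?_⟩
    · have := hu0 p.1
      simp only [Pi.zero_apply]
      positivity
    · simpa only [(hrow _).tsum_eq] using hlog.neg
  have htotal : HasSum (fun p : ℕ × ℕ ↦ (t * q ^ (p.1 + 1)) ^ (p.2 + 1) / ((p.2 : ℝ) + 1))
      (-Real.log (∏' n : ℕ, (1 - t * q ^ (n + 1)))) := by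
    convert hsum.hasSum using 1
    rw [hsum.tsum_prod' fun n ↦ (hrow n).summable, hprod, ← tsum_neg]
    exact tsum_congr fun n ↦ (hrow n).tsum_eq.symm
  exact ((Equiv.prodComm ℕ ℕ).hasSum_iff.2 htotal).prod_fiberwise hcol

lemma hasSum_Li2 {u : ℝ} (hu0 : 0 ≤ u) (hu1 : u ≤ 1) :
    HasSum (fun k : ℕ ↦ u ^ (k + 1) / ((k : ℝ) + 1) ^ 2) (Li2 u) := by
  refine Summable.hasSum (Summable.of_nonneg_of_le (fun k ↦ by positivity) (fun k ↦ ?_)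
    ((summable_nat_add_iff 1).2 (Real.summable_one_div_nat_pow.2 one_lt_two)))
  push_cast
  gcongr
  exact pow_le_one₀ hu0 hu1

/-- Proposition 2.6, lower bound: For real `0 ≤ t ≤ 1` and `γ > 0`,
`-log ∏_{n=1}^∞ (1 - t e^{-nγ}) ≥ γ⁻¹ Li₂(t e^{-γ}) - (1/2) log(1 - t e^{-γ})`;
moreover, if `t < 1`, then
`-log ∏_{n=1}^∞ (1 - t e^{-nγ}) ≥ γ⁻¹ Li₂(t) + (1/2) log(1 - t)`. -/
theorem stmt11 (t γ : ℝ) (ht0 : 0 ≤ t) (ht1 : t ≤ 1) (hγ : 0 < γ) :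
    γ⁻¹ * Li2 (t * Real.exp (-γ)) - (1 / 2) * Real.log (1 - t * Real.exp (-γ)) ≤
      -Real.log (∏' n : ℕ, (1 - t * Real.exp (-((n : ℝ) + 1) * γ))) ∧
    (t < 1 →
      γ⁻¹ * Li2 t + (1 / 2) * Real.log (1 - t) ≤
        -Real.log (∏' n : ℕ, (1 - t * Real.exp (-((n : ℝ) + 1) * γ)))) := by
  have hq0 := Real.exp_pos (-γ)
  have hq1 : Real.exp (-γ) < 1 := by simpa using hγ
  have hpow : ∀ k : ℕ, Real.exp (-γ) ^ (k + 1) = Real.exp (-(((k : ℝ) + 1) * γ)) := by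
    intro k
    rw [← Real.exp_nat_mul]
    push_cast
    ring_nf
  have hmain := hasSum_neg_log_tprod_one_sub_mul_pow ht0 ht1 hq0 hq1
  simp only [hpow, ← neg_mul] at hmain
  have hu0 : 0 ≤ t * Real.exp (-γ) := by positivity
  have hu1 : t * Real.exp (-γ) < 1 := (mul_le_of_le_one_left hq0.le ht1).trans_lt hq1
  have hkey : ∀ k : ℕ, (((k : ℝ) + 1) * γ)⁻¹ + 1 / 2 ≤
      (1 - Real.exp (-((k : ℝ) + 1) * γ))⁻¹ := by
    intro k
    rw [neg_mul]
    exact inv_add_half_le_inv_one_sub_exp_neg (by positivity)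
  constructor
  · have hlog := Real.hasSum_pow_div_log_of_abs_lt_one (abs_lt.2 ⟨by linarith, hu1⟩)
    have hleft := ((hasSum_Li2 hu0 hu1.le).mul_left γ⁻¹).add (hlog.mul_left (1 / 2))
    rw [mul_neg, ← sub_eq_add_neg] at hleft
    refine hasSum_le (fun k ↦ ?_) hleft hmain
    refine le_trans (le_of_eq ?_) (mul_le_mul_of_nonneg_left (hkey k) (by positivity))
    field_simp
  · intro ht
    have hlog := Real.hasSum_pow_div_log_of_abs_lt_one (abs_lt.2 ⟨by linarith, ht⟩)
    have hleft := ((hasSum_Li2 ht0 ht1).mul_left γ⁻¹).sub (hlog.mul_left (1 / 2))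
    rw [mul_neg, sub_neg_eq_add] at hleft
    refine hasSum_le (fun k ↦ ?_) hleft hmain
    have hne : 1 - Real.exp (-((k : ℝ) + 1) * γ) ≠ 0 := by
      rw [neg_mul, ← hpow]
      exact (sub_pos.2 (pow_lt_one₀ hq0.le hq1 k.succ_ne_zero)).ne'
    calc γ⁻¹ * (t ^ (k + 1) / ((k : ℝ) + 1) ^ 2) - 1 / 2 * (t ^ (k + 1) / ((k : ℝ) + 1))
        = t ^ (k + 1) / ((k : ℝ) + 1) * ((((k : ℝ) + 1) * γ)⁻¹ + 1 / 2 - 1) := by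
          field_simp
          ring
      _ ≤ t ^ (k + 1) / ((k : ℝ) + 1) * ((1 - Real.exp (-((k : ℝ) + 1) * γ))⁻¹ - 1) := by
          gcongr
          exact hkey k
      _ = (t * Real.exp (-γ)) ^ (k + 1) / ((k : ℝ) + 1) *
            (1 - Real.exp (-((k : ℝ) + 1) * γ))⁻¹ := by
          rw [mul_pow, hpow, ← neg_mul]
          generalize Real.exp (-((k : ℝ) + 1) * γ) = y at hne ⊢
          field_simp
          ring
end
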